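/- arXiv:1808.01498 — 2 statements merged into one kernel-verified Lean document; each statement's English description precedes it below -/
import Mathlib

section
/- Amortization collapse of the Petz–Rényi divergences for classical-quantum channels: let N, M : X → B be classical-quantum channels determined by finite families of states {ν_B^x}_{x∈X} and {μ_B^x}_{x∈X}. Then for all α ∈ [0,2], the amortized Petz–Rényi channel divergence satisfies D_α^A(N‖M) = max_{x∈X} D_α(ν_B^x ‖ μ_B^x). -/
open scoped BigOperators ComplexOrder

noncomputable section

attribute [local instance] Classical.propDecidable

/-- A density matrix (quantum state): positive semidefinite with unit trace. -/
def IsDensity {ι : Type} [Fintype ι] (ρ : Matrix ι ι ℂ) : Prop :=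
  ρ.PosSemidef ∧ ρ.trace = 1

/-- The map `id_R ⊗ Φ` (for linear `Φ`), defined blockwise. -/
def idTensor {R ι κ : Type} (Φ : Matrix ι ι ℂ → Matrix κ κ ℂ)
    (X : Matrix (R × ι) (R × ι) ℂ) : Matrix (R × κ) (R × κ) ℂ :=
  fun p q => Φ (fun a b => X (p.1, a) (q.1, b)) p.2 q.2

/-- The map `Φ ⊗ id_E` (for linear `Φ`), defined blockwise. -/
def tensorId {ι κ E : Type} (Φ : Matrix ι ι ℂ → Matrix κ κ ℂ)
    (X : Matrix (ι × E) (ι × E) ℂ) : Matrix (κ × E) (κ × E) ℂ :=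
  fun p q => Φ (fun a b => X (a, p.2) (b, q.2)) p.1 q.1

/-- A quantum channel: linear, trace preserving, and completely positive. -/
structure IsChannel {ι κ : Type} [Fintype ι] [Fintype κ]
    (Φ : Matrix ι ι ℂ → Matrix κ κ ℂ) : Prop where
  linear : IsLinearMap ℂ Φ
  tracePres : ∀ X, (Φ X).trace = X.trace
  compPos : ∀ (k : ℕ) (X : Matrix (Fin k × ι) (Fin k × ι) ℂ),
      X.PosSemidef → (idTensor Φ X).PosSemidef

/-- A family of divergences, one for every finite dimension. -/
abbrev DivFam : Type 1 :=
  ∀ (ι : Type) [Fintype ι] [DecidableEq ι], Matrix ι ι ℂ → Matrix ι ι ℂ → EReal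

/-- Data processing: a generalized divergence does not increase under channels. -/
def DivDataProcessing (D : DivFam) : Prop :=
  ∀ (ι κ : Type) [Fintype ι] [DecidableEq ι] [Fintype κ] [DecidableEq κ]
    (Φ : Matrix ι ι ℂ → Matrix κ κ ℂ), IsChannel Φ →
    ∀ ρ σ : Matrix ι ι ℂ, IsDensity ρ → IsDensity σ →
      D κ (Φ ρ) (Φ σ) ≤ D ι ρ σ

/-- Faithfulness: `D(ρ‖ρ) ≤ 0` for every state `ρ`. -/
def DivFaithful (D : DivFam) : Prop :=
  ∀ (ι : Type) [Fintype ι] [DecidableEq ι] (ρ : Matrix ι ι ℂ),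
    IsDensity ρ → D ι ρ ρ ≤ 0

/-- Strong faithfulness: `D(ρ‖σ) = 0` iff `ρ = σ`. -/
def DivStronglyFaithful (D : DivFam) : Prop :=
  ∀ (ι : Type) [Fintype ι] [DecidableEq ι] (ρ σ : Matrix ι ι ℂ),
    IsDensity ρ → IsDensity σ → (D ι ρ σ = 0 ↔ ρ = σ)

/-- The generalized channel divergence `D(N‖M)`. -/
def channelDiv (D : DivFam) {ι κ : Type} [Fintype ι] [DecidableEq ι] [Fintype κ] [DecidableEq κ]
    (N M : Matrix ι ι ℂ → Matrix κ κ ℂ) : EReal :=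
  ⨆ (R : ℕ) (ρ : Matrix (Fin R × ι) (Fin R × ι) ℂ) (_ : IsDensity ρ),
    D (Fin R × κ) (idTensor N ρ) (idTensor M ρ)

/-- The amortized channel divergence `D^𝒜(N‖M)`. -/
def amortizedDiv (D : DivFam) {ι κ : Type} [Fintype ι] [DecidableEq ι] [Fintype κ] [DecidableEq κ]
    (N M : Matrix ι ι ℂ → Matrix κ κ ℂ) : EReal :=
  ⨆ (R : ℕ) (ρ : Matrix (Fin R × ι) (Fin R × ι) ℂ) (σ : Matrix (Fin R × ι) (Fin R × ι) ℂ)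
    (_ : IsDensity ρ) (_ : IsDensity σ),
      D (Fin R × κ) (idTensor N ρ) (idTensor M σ) - D (Fin R × ι) ρ σ

/-- Apply a real function to a Hermitian matrix via the spectral decomposition. -/
def hermFun {ι : Type} [Fintype ι] [DecidableEq ι] (f : ℝ → ℝ) (A : Matrix ι ι ℂ) :
    Matrix ι ι ℂ :=
  if hA : A.IsHermitian then
    (hA.eigenvectorUnitary : Matrix ι ι ℂ) *
      Matrix.diagonal (fun i => (f (hA.eigenvalues i) : ℂ)) *
      star (hA.eigenvectorUnitary : Matrix ι ι ℂ)
  else 0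

/-- Real matrix power via spectral calculus, with the generalized-inverse convention `0 ↦ 0`. -/
def matPow {ι : Type} [Fintype ι] [DecidableEq ι] (A : Matrix ι ι ℂ) (r : ℝ) : Matrix ι ι ℂ :=
  hermFun (fun x => if x = 0 then 0 else Real.rpow x r) A

/-- Matrix base-2 logarithm via spectral calculus, taken on the support. -/
def matLog2 {ι : Type} [Fintype ι] [DecidableEq ι] (A : Matrix ι ι ℂ) : Matrix ι ι ℂ :=
  hermFun (fun x => if x = 0 then 0 else Real.logb 2 x) A

/-- The projection onto the support of a Hermitian matrix. -/
def suppProj {ι : Type} [Fintype ι] [DecidableEq ι] (A : Matrix ι ι ℂ) : Matrix ι ι ℂ :=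
  hermFun (fun x => if x = 0 then 0 else 1) A

/-- `supp ρ ⊆ supp σ`, expressed (for Hermitian matrices) as kernel containment
`ker σ ⊆ ker ρ`. -/
def suppLE {ι : Type} [Fintype ι] (ρ σ : Matrix ι ι ℂ) : Prop :=
  ∀ v : ι → ℂ, σ.mulVec v = 0 → ρ.mulVec v = 0

/-- The quantum relative entropy `D(ρ‖σ) = Tr[ρ(log₂ρ − log₂σ)]`,
`+∞` if the support condition fails. -/
def relEnt {ι : Type} [Fintype ι] [DecidableEq ι] (ρ σ : Matrix ι ι ℂ) : EReal :=
  if suppLE ρ σ then (((ρ * (matLog2 ρ - matLog2 σ)).trace).re : EReal) else ⊤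

/-- `−log₂ x` as an extended real, with `−log₂ 0 = +∞`. -/
def negLog2 (x : ℝ) : EReal :=
  if x ≤ 0 then ⊤ else ((-Real.logb 2 x : ℝ) : EReal)

/-- The max-relative entropy `D_max(ρ‖σ) = inf{λ : ρ ≤ 2^λ σ}` (Loewner order). -/
def Dmax {ι : Type} [Fintype ι] (ρ σ : Matrix ι ι ℂ) : EReal :=
  ⨅ (l : ℝ) (_ : (((2 : ℝ) ^ l) • σ - ρ).PosSemidef), (l : EReal)

/-- The sandwiched Rényi divergence `D̃_α`. -/
def sandRenyi {ι : Type} [Fintype ι] [DecidableEq ι] (α : ℝ) (ρ σ : Matrix ι ι ℂ) : EReal :=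
  if α = 1 then relEnt ρ σ
  else if 1 < α ∧ ¬ suppLE ρ σ then ⊤
  else if α < 1 ∧ (ρ * σ).trace = 0 then ⊤
  else ((((α - 1)⁻¹ *
      Real.logb 2
        (((matPow (matPow σ ((1 - α) / (2 * α)) * ρ * matPow σ ((1 - α) / (2 * α))) α).trace).re)) :
        ℝ) : EReal)

/-- The Petz–Rényi divergence `D_α`. -/
def petzRenyi {ι : Type} [Fintype ι] [DecidableEq ι] (α : ℝ) (ρ σ : Matrix ι ι ℂ) : EReal :=
  if α = 0 then negLog2 (((suppProj ρ * σ).trace).re)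
  else if α = 1 then relEnt ρ σ
  else if 1 < α ∧ ¬ suppLE ρ σ then ⊤
  else if α < 1 ∧ (ρ * σ).trace = 0 then ⊤
  else ((((α - 1)⁻¹ * Real.logb 2 (((matPow ρ α * matPow σ (1 - α)).trace).re)) : ℝ) : EReal)

/-- The trace norm `‖X‖₁ = Tr √(XᴴX)`. -/
def traceNorm {ι : Type} [Fintype ι] [DecidableEq ι] (X : Matrix ι ι ℂ) : ℝ :=
  ((matPow (X.conjTranspose * X) (1/2 : ℝ)).trace).re

/-- The fidelity `F(ρ,σ) = ‖√ρ√σ‖₁²`. -/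
def matFidelity {ι : Type} [Fintype ι] [DecidableEq ι] (ρ σ : Matrix ι ι ℂ) : ℝ :=
  (traceNorm (matPow ρ (1/2 : ℝ) * matPow σ (1/2 : ℝ))) ^ 2

def relEntFam : DivFam := fun _ _ _ ρ σ => relEnt ρ σ
def DmaxFam : DivFam := fun _ _ _ ρ σ => Dmax ρ σ
def sandFam (α : ℝ) : DivFam := fun _ _ _ ρ σ => sandRenyi α ρ σ
def petzFam (α : ℝ) : DivFam := fun _ _ _ ρ σ => petzRenyi α ρ σ
/-- `D̃_{1/2}(ρ‖σ) = −log₂ F(ρ,σ)` as a divergence family. -/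
def fidDivFam : DivFam := fun _ _ _ ρ σ => negLog2 (matFidelity ρ σ)

/-- The classical-quantum state `Σ_x p(x) |x⟩⟨x| ⊗ ρ^x`. -/
def cqState {X ι : Type} [DecidableEq X] (p : X → ℝ) (ρ : X → Matrix ι ι ℂ) :
    Matrix (X × ι) (X × ι) ℂ :=
  fun a b => if a.1 = b.1 then (p a.1 : ℂ) * ρ a.1 a.2 b.2 else 0

/-- The direct-sum property of a generalized divergence on classical-quantum states. -/
def DivDirectSum (D : DivFam) : Prop :=
  ∀ (X ι : Type) [Fintype X] [DecidableEq X] [Fintype ι] [DecidableEq ι]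
    (p : X → ℝ), (∀ x, 0 ≤ p x) → (∑ x, p x = 1) →
    ∀ (ρ σ : X → Matrix ι ι ℂ), (∀ x, IsDensity (ρ x)) → (∀ x, IsDensity (σ x)) →
      D (X × ι) (cqState p ρ) (cqState p σ) = ∑ x, (p x : EReal) * D ι (ρ x) (σ x)

/-- The Kronecker (tensor) product of square matrices. -/
def mkron {ι E : Type} (A : Matrix ι ι ℂ) (B : Matrix E E ℂ) : Matrix (ι × E) (ι × E) ℂ :=
  fun p q => A p.1 q.1 * B p.2 q.2

/-- Sub-additivity of a divergence with respect to tensor-product states. -/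
def DivSubAdditive (D : DivFam) : Prop :=
  ∀ (ι E : Type) [Fintype ι] [DecidableEq ι] [Fintype E] [DecidableEq E]
    (ρ σ : Matrix ι ι ℂ) (ω τ : Matrix E E ℂ),
    IsDensity ρ → IsDensity σ → IsDensity ω → IsDensity τ →
      D (ι × E) (mkron ρ ω) (mkron σ τ) ≤ D ι ρ σ + D E ω τ

/-- The classical-quantum channel `ρ ↦ Σ_x ⟨x|ρ|x⟩ ν^x`. -/
def cqChannel {X κ : Type} [Fintype X] [Fintype κ] (ν : X → Matrix κ κ ℂ) :
    Matrix X X ℂ → Matrix κ κ ℂ :=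
  fun ρ => ∑ x, ρ x x • ν x

/-- The maximally entangled state of Schmidt rank `|ι|` on `ι × ι`. -/
def maxEnt (ι : Type) [Fintype ι] [DecidableEq ι] : Matrix (ι × ι) (ι × ι) ℂ :=
  fun p q => if p.1 = p.2 ∧ q.1 = q.2 then ((Fintype.card ι : ℂ))⁻¹ else 0

/-- An `(m+1)`-round adaptive channel discrimination protocol: registers `R_0, …, R_m`,
a shared initial state, adaptive channels between channel uses, and a final measurement. -/
structure Protocol (ι κ : Type) [Fintype ι] [DecidableEq ι] [Fintype κ] [DecidableEq κ]
    (m : ℕ) where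
  r : ℕ → ℕ
  init : Matrix (Fin (r 0) × ι) (Fin (r 0) × ι) ℂ
  init_density : IsDensity init
  adapt : ∀ i : ℕ, Matrix (Fin (r i) × κ) (Fin (r i) × κ) ℂ →
      Matrix (Fin (r (i + 1)) × ι) (Fin (r (i + 1)) × ι) ℂ
  adapt_channel : ∀ i, i < m → IsChannel (adapt i)
  meas : Matrix (Fin (r m) × κ) (Fin (r m) × κ) ℂ
  meas_psd : meas.PosSemidef
  meas_le_one : ((1 : Matrix (Fin (r m) × κ) (Fin (r m) × κ) ℂ) - meas).PosSemidef

namespace Protocol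

variable {ι κ : Type} [Fintype ι] [DecidableEq ι] [Fintype κ] [DecidableEq κ] {m : ℕ}

/-- The state on `R_i ⊗ A` just before the `(i+1)`-st channel use, when the channel is `Ch`. -/
def evolve (P : Protocol ι κ m) (Ch : Matrix ι ι ℂ → Matrix κ κ ℂ) :
    (i : ℕ) → Matrix (Fin (P.r i) × ι) (Fin (P.r i) × ι) ℂ
  | 0 => P.init
  | (i + 1) => P.adapt i (idTensor Ch (P.evolve Ch i))

/-- The final state on `R_m ⊗ B` after all `m + 1` channel uses. -/
def final (P : Protocol ι κ m) (Ch : Matrix ι ι ℂ → Matrix κ κ ℂ) :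
    Matrix (Fin (P.r m) × κ) (Fin (P.r m) × κ) ℂ :=
  idTensor Ch (P.evolve Ch m)

/-- The probability of accepting (deciding for the null hypothesis). -/
def acceptProb (P : Protocol ι κ m) (Ch : Matrix ι ι ℂ → Matrix κ κ ℂ) : ℝ :=
  ((P.meas * P.final Ch).trace).re

/-- The type I error probability `Tr[(I − Q) ρ'⁽ⁿ⁾]`. -/
def typeI (P : Protocol ι κ m) (N : Matrix ι ι ℂ → Matrix κ κ ℂ) : ℝ :=
  ((((1 : Matrix (Fin (P.r m) × κ) (Fin (P.r m) × κ) ℂ) - P.meas) * P.final N).trace).re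

/-- The type II error probability `Tr[Q τ'⁽ⁿ⁾]`. -/
def typeII (P : Protocol ι κ m) (M : Matrix ι ι ℂ → Matrix κ κ ℂ) : ℝ :=
  ((P.meas * P.final M).trace).re

end Protocol

/-- The binary (classical) state `diag(p, 1−p)`. -/
def binState (p : ℝ) : Matrix (Fin 2) (Fin 2) ℂ :=
  Matrix.diagonal (fun i => if i = 0 then (p : ℂ) else ((1 - p : ℝ) : ℂ))

/-- The binary entropy `h₂(ε)`. -/
def h2 (ε : ℝ) : ℝ := -(ε * Real.logb 2 ε) - (1 - ε) * Real.logb 2 (1 - ε)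

/-- `ζ_n(ε, N, M)` with `n = m + 1`: the optimal type II error exponent among all
`(m+1)`-round adaptive protocols with type I error at most `ε`. -/
def steinExp {ι κ : Type} [Fintype ι] [DecidableEq ι] [Fintype κ] [DecidableEq κ]
    (N M : Matrix ι ι ℂ → Matrix κ κ ℂ) (m : ℕ) (ε : ℝ) : EReal :=
  ⨆ (P : Protocol ι κ m) (_ : P.typeI N ≤ ε),
    (((m + 1 : ℝ))⁻¹ : EReal) * negLog2 (P.typeII M)

/-- Partial trace over the (left) reference system. -/
def ptraceLeft {R ι : Type} [Fintype R] (ψ : Matrix (R × ι) (R × ι) ℂ) : Matrix ι ι ℂ :=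
  fun a b => ∑ r, ψ (r, a) (r, b)

/-- The energy-constrained generalized channel divergence. -/
def eChannelDiv (D : DivFam) {ι κ : Type} [Fintype ι] [DecidableEq ι] [Fintype κ] [DecidableEq κ]
    (H : Matrix ι ι ℂ) (E : ℝ) (N M : Matrix ι ι ℂ → Matrix κ κ ℂ) : EReal :=
  ⨆ (R : ℕ) (ψ : Matrix (Fin R × ι) (Fin R × ι) ℂ) (_ : IsDensity ψ)
    (_ : ((H * ptraceLeft ψ).trace).re ≤ E),
      D (Fin R × κ) (idTensor N ψ) (idTensor M ψ)

/-- The energy-constrained amortized channel divergence. -/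
def eAmortizedDiv (D : DivFam) {ι κ : Type} [Fintype ι] [DecidableEq ι] [Fintype κ] [DecidableEq κ]
    (H : Matrix ι ι ℂ) (E : ℝ) (N M : Matrix ι ι ℂ → Matrix κ κ ℂ) : EReal :=
  ⨆ (R : ℕ) (ρ : Matrix (Fin R × ι) (Fin R × ι) ℂ) (σ : Matrix (Fin R × ι) (Fin R × ι) ℂ)
    (_ : IsDensity ρ) (_ : IsDensity σ)
    (_ : ((H * ptraceLeft ρ).trace).re ≤ E) (_ : ((H * ptraceLeft σ).trace).re ≤ E),
      D (Fin R × κ) (idTensor N ρ) (idTensor M σ) - D (Fin R × ι) ρ σ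

/-- `sup_α(ρ/σ)`: supremum of `Tr[Λρ]/Tr[Λσ]` over Hermitian `Λ` with `α⁻¹ I ≤ Λ ≤ I`. -/
def hilbertSup {ι : Type} [Fintype ι] [DecidableEq ι] (α : ℝ) (ρ σ : Matrix ι ι ℂ) : ℝ :=
  sSup { t : ℝ | ∃ Λ : Matrix ι ι ℂ, Λ.IsHermitian ∧
    (Λ - (α⁻¹ : ℝ) • (1 : Matrix ι ι ℂ)).PosSemidef ∧
    ((1 : Matrix ι ι ℂ) - Λ).PosSemidef ∧
    t = ((Λ * ρ).trace).re / ((Λ * σ).trace).re }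

/-- The Hilbert `α`-divergence `H_α(ρ‖σ)`, with `H₁(ρ‖σ) = ‖ρ−σ‖₁ / (2 ln 2)`. -/
def hilbertDiv {ι : Type} [Fintype ι] [DecidableEq ι] (α : ℝ) (ρ σ : Matrix ι ι ℂ) : ℝ :=
  if α = 1 then (2 * Real.log 2)⁻¹ * traceNorm (ρ - σ)
  else (α / (α - 1)) * Real.logb 2 (hilbertSup α ρ σ)

/-- Real power with the convention that `0 ↦ 0` for every exponent. -/
def pinvPow (x r : ℝ) : ℝ := if x = 0 then 0 else Real.rpow x r

lemma pinvPow_zero_left (r : ℝ) : pinvPow 0 r = 0 := if_pos rfl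

lemma pinvPow_of_ne {x : ℝ} (hx : x ≠ 0) (r : ℝ) : pinvPow x r = x ^ r := if_neg hx

lemma pinvPow_nonneg {x : ℝ} (hx : 0 ≤ x) (r : ℝ) : 0 ≤ pinvPow x r := by
  unfold pinvPow
  split_ifs
  exacts [le_rfl, Real.rpow_nonneg hx r]

lemma pinvPow_pos {x : ℝ} (hx : 0 < x) (r : ℝ) : 0 < pinvPow x r := by
  rw [pinvPow_of_ne hx.ne']
  exact Real.rpow_pos_of_pos hx r

lemma pinvPow_mul {x y : ℝ} (hx : 0 ≤ x) (hy : 0 ≤ y) (r : ℝ) :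
    pinvPow (x * y) r = pinvPow x r * pinvPow y r := by
  rcases eq_or_ne x 0 with rfl | hx0
  · simp [pinvPow_zero_left]
  rcases eq_or_ne y 0 with rfl | hy0
  · simp [pinvPow_zero_left]
  rw [pinvPow_of_ne hx0, pinvPow_of_ne hy0, pinvPow_of_ne (mul_ne_zero hx0 hy0),
    Real.mul_rpow hx hy]

lemma pinvPow_one_right (x : ℝ) : pinvPow x 1 = x := by
  unfold pinvPow
  split_ifs with h
  exacts [h.symm, Real.rpow_one x]

lemma continuous_pinvPow (x : ℝ) : Continuous (pinvPow x) := by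
  rcases eq_or_ne x 0 with rfl | hx
  · simpa only [funext pinvPow_zero_left] using continuous_const
  · simpa only [funext (pinvPow_of_ne hx)] using Real.continuous_const_rpow hx

/-- The quasi-entropy of order `α` of a weighted family of pairs of nonnegative numbers. -/
def quasiSum {I : Type} [Fintype I] (w a b : I → ℝ) (α : ℝ) : ℝ :=
  ∑ i, w i * (pinvPow (a i) α * pinvPow (b i) (1 - α))

/-- The weighted sum of the parallel sums of `a` and `t b`. -/
def parallelSum {I : Type} [Fintype I] (w a b : I → ℝ) (t : ℝ) : ℝ :=
  ∑ i, w i * (t * a i * b i / (a i + t * b i))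

lemma continuous_quasiSum {I : Type} [Fintype I] (w a b : I → ℝ) :
    Continuous (quasiSum w a b) := by
  unfold quasiSum
  have h (i : I) : Continuous fun α : ℝ => pinvPow (b i) (1 - α) :=
    (continuous_pinvPow _).comp (by fun_prop)
  exact continuous_finsetSum _ fun i _ =>
    continuous_const.mul ((continuous_pinvPow _).mul (h i))

lemma quasiSum_one {I : Type} [Fintype I] {w a b : I → ℝ}
    (hs : ∀ i, b i = 0 → w i * a i = 0) : quasiSum w a b 1 = ∑ i, w i * a i := by
  refine Finset.sum_congr rfl fun i _ => ?_
  rw [pinvPow_one_right, sub_self]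
  rcases eq_or_ne (b i) 0 with h | h
  · rw [h, pinvPow_zero_left, mul_zero, mul_zero, hs i h]
  · rw [pinvPow_of_ne h, Real.rpow_zero, mul_one]

lemma quasiSum_nonneg {I : Type} [Fintype I] {w a b : I → ℝ} (hw : ∀ i, 0 ≤ w i)
    (ha : ∀ i, 0 ≤ a i) (hb : ∀ i, 0 ≤ b i) (α : ℝ) : 0 ≤ quasiSum w a b α :=
  Finset.sum_nonneg fun i _ => mul_nonneg (hw i)
    (mul_nonneg (pinvPow_nonneg (ha i) _) (pinvPow_nonneg (hb i) _))

lemma quasiSum_pos {I : Type} [Fintype I] {w a b : I → ℝ} (hw : ∀ i, 0 ≤ w i)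
    (ha : ∀ i, 0 ≤ a i) (hb : ∀ i, 0 ≤ b i) (hs : ∀ i, b i = 0 → w i * a i = 0)
    (h1 : ∑ i, w i * a i ≠ 0) (α : ℝ) : 0 < quasiSum w a b α := by
  obtain ⟨i, -, hi⟩ := Finset.exists_ne_zero_of_sum_ne_zero h1
  have hbi : b i ≠ 0 := fun h => hi (hs i h)
  refine Finset.sum_pos' (fun j _ => mul_nonneg (hw j)
    (mul_nonneg (pinvPow_nonneg (ha j) _) (pinvPow_nonneg (hb j) _))) ⟨i, Finset.mem_univ i, ?_⟩
  exact mul_pos ((hw i).lt_of_ne' (left_ne_zero_of_mul hi))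
    (mul_pos (pinvPow_pos ((ha i).lt_of_ne' (right_ne_zero_of_mul hi)) _)
      (pinvPow_pos ((hb i).lt_of_ne' hbi) _))

lemma quasiSum_eq_zero_iff {I : Type} [Fintype I] {w a b : I → ℝ} (hw : ∀ i, 0 ≤ w i)
    (ha : ∀ i, 0 ≤ a i) (hb : ∀ i, 0 ≤ b i) (α : ℝ) :
    quasiSum w a b α = 0 ↔ ∑ i, w i * (a i * b i) = 0 := by
  have hz {x : ℝ} (hx : 0 ≤ x) (r : ℝ) : pinvPow x r = 0 ↔ x = 0 := by
    refine ⟨fun h => ?_, fun h => h ▸ pinvPow_zero_left r⟩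
    by_contra hx0
    exact (pinvPow_pos (hx.lt_of_ne' hx0) r).ne' h
  unfold quasiSum
  rw [Finset.sum_eq_zero_iff_of_nonneg fun i _ => mul_nonneg (hw i)
    (mul_nonneg (pinvPow_nonneg (ha i) _) (pinvPow_nonneg (hb i) _)),
    Finset.sum_eq_zero_iff_of_nonneg fun i _ => mul_nonneg (hw i) (mul_nonneg (ha i) (hb i))]
  simp only [mul_eq_zero, hz (ha _), hz (hb _)]

open MeasureTheory Set in
lemma pinvPow_mul_eq_integral_of_lt_one {α a b : ℝ} (hα : α ∈ Ioo (0 : ℝ) 1) (ha : 0 ≤ a)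
    (hb : 0 ≤ b) :
    IntegrableOn (fun t : ℝ => t ^ (α - 2) * (t * a * b / (a + t * b))) (Ioi 0) ∧
      pinvPow a α * pinvPow b (1 - α) = (∫ t in Ioi 0, Real.rpowIntegrand₀₁ α t 1)⁻¹ *
        ∫ t in Ioi (0 : ℝ), t ^ (α - 2) * (t * a * b / (a + t * b)) := by
  rcases hb.eq_or_lt with rfl | hb
  · simp [pinvPow_zero_left]
  have hx : 0 ≤ a / b := by positivity
  have key : EqOn (fun t : ℝ => t ^ (α - 2) * (t * a * b / (a + t * b)))
      (fun t => b * Real.rpowIntegrand₀₁ α t (a / b)) (Ioi 0) := by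
    intro t (ht : 0 < t)
    have h2 : t ^ (α - 1) = t ^ (α - 2) * t := by
      rw [← Real.rpow_add_one ht.ne']; ring_nf
    have h3 : a + t * b ≠ 0 := by positivity
    have h4 : t + a / b ≠ 0 := by positivity
    have h5 : t * b + a ≠ 0 := by positivity
    simp only [Real.rpowIntegrand₀₁_eq_pow_div hα ht.le hx, h2]
    field_simp
    ring
  refine ⟨IntegrableOn.congr_fun ((Real.integrableOn_rpowIntegrand₀₁_Ioi hα hx).const_mul b)
    key.symm measurableSet_Ioi, ?_⟩
  rw [setIntegral_congr_fun measurableSet_Ioi key, integral_const_mul, mul_left_comm,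
    ← Real.rpow_eq_const_mul_integral hα hx, pinvPow_of_ne hb.ne']
  rcases ha.eq_or_lt with rfl | ha
  · simp [pinvPow_zero_left, Real.zero_rpow hα.1.ne']
  · rw [pinvPow_of_ne ha.ne', Real.div_rpow ha.le hb.le, Real.rpow_sub hb, Real.rpow_one]
    ring

open MeasureTheory Set in
lemma pinvPow_mul_eq_integral_of_one_lt {α w a b : ℝ} (hα : α ∈ Ioo (1 : ℝ) 2) (ha : 0 ≤ a)
    (hb : 0 ≤ b) (hs : b = 0 → w * a = 0) :
    IntegrableOn (fun t : ℝ => t ^ (α - 2) * (w * (a - t * a * b / (a + t * b)))) (Ioi 0) ∧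
      w * (pinvPow a α * pinvPow b (1 - α)) =
        (∫ t in Ioi 0, Real.rpowIntegrand₀₁ (α - 1) t 1)⁻¹ *
          ∫ t in Ioi (0 : ℝ), t ^ (α - 2) * (w * (a - t * a * b / (a + t * b))) := by
  rcases hb.eq_or_lt with rfl | hb
  · simp [pinvPow_zero_left, hs rfl]
  have hx : 0 ≤ a / b := by positivity
  have hα' : α - 1 ∈ Ioo (0 : ℝ) 1 := ⟨by linarith [hα.1], by linarith [hα.2]⟩
  have key : EqOn (fun t : ℝ => t ^ (α - 2) * (w * (a - t * a * b / (a + t * b))))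
      (fun t => w * b * Real.rpowIntegrand₁₂ α t (a / b)) (Ioi 0) := by
    intro t (ht : 0 < t)
    have h3 : a + t * b ≠ 0 := by positivity
    have h4 : t + a / b ≠ 0 := by positivity
    have h5 : t * b + a ≠ 0 := by positivity
    simp only [Real.rpowIntegrand₁₂_eq_mul_rpowIntegrand₀₁ hx ht,
      Real.rpowIntegrand₀₁_eq_pow_div hα' ht.le hx, show α - 1 - 1 = α - 2 by ring]
    field_simp
    ring
  refine ⟨IntegrableOn.congr_fun ((Real.integrableOn_rpowIntegrand₁₂ hα hx).const_mul (w * b))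
    key.symm measurableSet_Ioi, ?_⟩
  rw [setIntegral_congr_fun measurableSet_Ioi key, integral_const_mul,
    mul_left_comm (∫ t in Ioi 0, Real.rpowIntegrand₀₁ (α - 1) t 1)⁻¹,
    ← Real.rpow_eq_const_mul_integral_rpowIntegrand₁₂ hα hx, pinvPow_of_ne hb.ne']
  rcases ha.eq_or_lt with rfl | ha
  · simp [pinvPow_zero_left, Real.zero_rpow (by linarith [hα.1] : α ≠ 0)]
  · rw [pinvPow_of_ne ha.ne', Real.div_rpow ha.le hb.le, Real.rpow_sub hb, Real.rpow_one]
    ring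

section Comparison

variable {I J : Type} [Fintype I] [Fintype J] {w a b : I → ℝ} {v c d : J → ℝ}

open MeasureTheory Set in
lemma quasiSum_eq_integral_of_lt_one {α : ℝ} (hα : α ∈ Ioo (0 : ℝ) 1) (ha : ∀ i, 0 ≤ a i)
    (hb : ∀ i, 0 ≤ b i) :
    IntegrableOn (fun t : ℝ => t ^ (α - 2) * parallelSum w a b t) (Ioi 0) ∧
      quasiSum w a b α = (∫ t in Ioi 0, Real.rpowIntegrand₀₁ α t 1)⁻¹ *
        ∫ t in Ioi (0 : ℝ), t ^ (α - 2) * parallelSum w a b t := by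
  have hfun : (fun t : ℝ => t ^ (α - 2) * parallelSum w a b t) = fun t =>
      ∑ i, w i * (t ^ (α - 2) * (t * a i * b i / (a i + t * b i))) := by
    funext t
    rw [parallelSum, Finset.mul_sum]
    exact Finset.sum_congr rfl fun i _ => mul_left_comm _ _ _
  have h (i : I) := pinvPow_mul_eq_integral_of_lt_one hα (ha i) (hb i)
  rw [hfun]
  refine ⟨integrable_finsetSum _ fun i _ => (h i).1.const_mul (w i), ?_⟩
  rw [integral_finsetSum _ fun i _ => (h i).1.const_mul (w i), Finset.mul_sum]
  refine Finset.sum_congr rfl fun i _ => ?_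
  rw [integral_const_mul, (h i).2, mul_left_comm]

open MeasureTheory Set in
lemma quasiSum_eq_integral_of_one_lt {α : ℝ} (hα : α ∈ Ioo (1 : ℝ) 2) (ha : ∀ i, 0 ≤ a i)
    (hb : ∀ i, 0 ≤ b i) (hs : ∀ i, b i = 0 → w i * a i = 0) :
    IntegrableOn (fun t : ℝ => t ^ (α - 2) * (∑ i, w i * a i - parallelSum w a b t)) (Ioi 0) ∧
      quasiSum w a b α = (∫ t in Ioi 0, Real.rpowIntegrand₀₁ (α - 1) t 1)⁻¹ *
        ∫ t in Ioi (0 : ℝ), t ^ (α - 2) * (∑ i, w i * a i - parallelSum w a b t) := by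
  have hfun : (fun t : ℝ => t ^ (α - 2) * (∑ i, w i * a i - parallelSum w a b t)) = fun t =>
      ∑ i, t ^ (α - 2) * (w i * (a i - t * a i * b i / (a i + t * b i))) := by
    funext t
    rw [parallelSum, ← Finset.sum_sub_distrib, Finset.mul_sum]
    simp only [mul_sub]
  have h (i : I) := pinvPow_mul_eq_integral_of_one_lt hα (ha i) (hb i) (hs i)
  rw [hfun]
  refine ⟨integrable_finsetSum _ fun i _ => (h i).1, ?_⟩
  rw [integral_finsetSum _ fun i _ => (h i).1, Finset.mul_sum]
  exact Finset.sum_congr rfl fun i _ => (h i).2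

open MeasureTheory Set in
lemma quasiSum_le_of_parallelSum_le (ha : ∀ i, 0 ≤ a i) (hb : ∀ i, 0 ≤ b i)
    (hc : ∀ j, 0 ≤ c j) (hd : ∀ j, 0 ≤ d j)
    (h : ∀ t, 0 < t → parallelSum w a b t ≤ parallelSum v c d t) {α : ℝ}
    (hα : α ∈ Icc (0 : ℝ) 1) : quasiSum w a b α ≤ quasiSum v c d α := by
  rw [← closure_Ioo zero_ne_one] at hα
  refine le_on_closure (fun β hβ => ?_) (continuous_quasiSum w a b).continuousOn
    (continuous_quasiSum v c d).continuousOn hα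
  obtain ⟨i₁, e₁⟩ := quasiSum_eq_integral_of_lt_one (w := w) hβ ha hb
  obtain ⟨i₂, e₂⟩ := quasiSum_eq_integral_of_lt_one (w := v) hβ hc hd
  rw [e₁, e₂]
  refine mul_le_mul_of_nonneg_left (setIntegral_mono_on i₁ i₂ measurableSet_Ioi ?_)
    (inv_nonneg.2 (Real.integral_rpowIntegrand₀₁_one_pos hβ).le)
  exact fun t ht => mul_le_mul_of_nonneg_left (h t ht) (Real.rpow_nonneg (le_of_lt ht) _)

open MeasureTheory Set in
lemma quasiSum_ge_of_parallelSum_le (ha : ∀ i, 0 ≤ a i) (hb : ∀ i, 0 ≤ b i)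
    (hc : ∀ j, 0 ≤ c j) (hd : ∀ j, 0 ≤ d j) (hs : ∀ i, b i = 0 → w i * a i = 0)
    (hs' : ∀ j, d j = 0 → v j * c j = 0) (htr : ∑ i, w i * a i = ∑ j, v j * c j)
    (h : ∀ t, 0 < t → parallelSum w a b t ≤ parallelSum v c d t) {α : ℝ}
    (hα : α ∈ Icc (1 : ℝ) 2) : quasiSum v c d α ≤ quasiSum w a b α := by
  rw [← closure_Ioo (by norm_num)] at hα
  refine le_on_closure (fun β hβ => ?_) (continuous_quasiSum v c d).continuousOn
    (continuous_quasiSum w a b).continuousOn hα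
  obtain ⟨i₁, e₁⟩ := quasiSum_eq_integral_of_one_lt hβ ha hb hs
  obtain ⟨i₂, e₂⟩ := quasiSum_eq_integral_of_one_lt hβ hc hd hs'
  rw [e₁, e₂]
  refine mul_le_mul_of_nonneg_left (setIntegral_mono_on i₂ i₁ measurableSet_Ioi ?_)
    (inv_nonneg.2 (Real.integral_rpowIntegrand₀₁_one_pos
      ⟨by linarith [hβ.1], by linarith [hβ.2]⟩).le)
  intro t ht
  refine mul_le_mul_of_nonneg_left ?_ (Real.rpow_nonneg (le_of_lt ht) _)
  rw [htr]
  exact sub_le_sub_left (h t ht) _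

end Comparison

/-- The squared moduli of the overlaps of two bases. -/
def overlap {n : Type} [Fintype n] (U V : Matrix n n ℂ) (p : n × n) : ℝ :=
  Complex.normSq ((star U * V) p.1 p.2)

lemma overlap_nonneg {n : Type} [Fintype n] (U V : Matrix n n ℂ) (p : n × n) : 0 ≤ overlap U V p :=
  Complex.normSq_nonneg _

section Diagonalization

open Matrix
open scoped Kronecker

variable {n m : Type} [Fintype n] [DecidableEq n] [Fintype m] [DecidableEq m]

/-- `A = U diag(a) Uᴴ` with `U` unitary. -/
structure IsDiagonalization (A U : Matrix n n ℂ) (a : n → ℝ) : Prop where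
  unitary : U ∈ Matrix.unitaryGroup n ℂ
  eq : A = U * diagonal (fun i => (a i : ℂ)) * star U

namespace IsDiagonalization

variable {A B C U V : Matrix n n ℂ} {a b : n → ℝ}

lemma star_mul_self (h : IsDiagonalization A U a) : star U * U = 1 :=
  Matrix.mem_unitaryGroup_iff'.1 h.unitary

lemma mul_star_self (h : IsDiagonalization A U a) : U * star U = 1 :=
  Matrix.mem_unitaryGroup_iff.1 h.unitary

lemma isHermitian (h : IsDiagonalization A U a) : A.IsHermitian := by
  rw [h.eq, Matrix.IsHermitian, ← star_eq_conjTranspose, star_mul, star_mul, star_star, mul_assoc,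
    star_eq_conjTranspose (diagonal _), diagonal_conjTranspose]
  congr 3
  funext i
  simp

lemma hermFun_eq (h : IsDiagonalization A U a) (f : ℝ → ℝ) :
    hermFun f A = U * diagonal (fun i => (f (a i) : ℂ)) * star U := by
  have hA := h.isHermitian
  rw [hermFun, dif_pos hA]
  set V : Matrix n n ℂ := (hA.eigenvectorUnitary : Matrix n n ℂ)
  have hV : star V * V = 1 := Unitary.coe_star_mul_self hA.eigenvectorUnitary
  have hV' : V * star V = 1 := Unitary.coe_mul_star_self hA.eigenvectorUnitary
  have hAV : A = V * diagonal (fun i => (hA.eigenvalues i : ℂ)) * star V := by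
    conv_lhs => rw [hA.spectral_theorem, Unitary.conjStarAlgAut_apply]
    rfl
  have hcomm : diagonal (fun i => (hA.eigenvalues i : ℂ)) * (star V * U) =
      (star V * U) * diagonal (fun i => (a i : ℂ)) := by
    have h1 : star V * A * U = star V * A * U := rfl
    conv_lhs at h1 => rw [hAV]
    conv_rhs at h1 => rw [h.eq]
    simpa only [mul_assoc, ← mul_assoc (star V) V, hV, one_mul, h.star_mul_self, mul_one] using h1
  have hcomm' : diagonal (fun i => (f (hA.eigenvalues i) : ℂ)) * (star V * U) =
      (star V * U) * diagonal (fun i => (f (a i) : ℂ)) := by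
    ext i j
    have hij := congrFun (congrFun hcomm i) j
    rw [diagonal_mul, mul_diagonal] at hij ⊢
    rw [mul_comm _ (a j : ℂ)] at hij
    rcases mul_eq_mul_right_iff.1 hij with h1 | h1
    · rw [Complex.ofReal_injective h1, mul_comm]
    · simp [h1]
  calc V * diagonal (fun i => (f (hA.eigenvalues i) : ℂ)) * star V
      = V * (diagonal (fun i => (f (hA.eigenvalues i) : ℂ)) * (star V * U)) * star U := by
        simp only [mul_assoc, h.mul_star_self, mul_one]
    _ = U * diagonal (fun i => (f (a i) : ℂ)) * star U := by
        rw [hcomm', ← mul_assoc V, ← mul_assoc V, hV', one_mul]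

lemma hermFun (h : IsDiagonalization A U a) (f : ℝ → ℝ) :
    IsDiagonalization (hermFun f A) U (fun i => f (a i)) :=
  ⟨h.unitary, h.hermFun_eq f⟩

lemma one : IsDiagonalization (1 : Matrix n n ℂ) 1 1 :=
  ⟨one_mem _, by simp⟩

lemma kronecker {C W : Matrix m m ℂ} {c : m → ℝ} (h : IsDiagonalization A U a)
    (h' : IsDiagonalization C W c) :
    IsDiagonalization (A ⊗ₖ C) (U ⊗ₖ W) (fun p => a p.1 * c p.2) := by
  refine ⟨Matrix.kronecker_mem_unitary h.unitary h'.unitary, ?_⟩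
  have hd : (diagonal fun p : n × m => ((a p.1 * c p.2 : ℝ) : ℂ)) =
      diagonal (fun i => (a i : ℂ)) ⊗ₖ diagonal (fun i => (c i : ℂ)) := by
    rw [diagonal_kronecker_diagonal]
    simp
  rw [hd, star_eq_conjTranspose, conjTranspose_kronecker, ← mul_kronecker_mul,
    ← mul_kronecker_mul, ← star_eq_conjTranspose, ← star_eq_conjTranspose, ← h.eq, ← h'.eq]

lemma submatrix (h : IsDiagonalization A U a) (e : m ≃ n) :
    IsDiagonalization (A.submatrix e e) (U.submatrix e e) (fun i => a (e i)) := by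
  have hs : star (U.submatrix e e) = (star U).submatrix e e := rfl
  refine ⟨?_, ?_⟩
  · rw [Matrix.mem_unitaryGroup_iff, hs, submatrix_mul_equiv, h.mul_star_self,
      submatrix_one_equiv]
  · have hd : (diagonal fun i => (a (e i) : ℂ)) =
        (diagonal fun i => (a i : ℂ)).submatrix e e := by
      rw [submatrix_diagonal_equiv]
      rfl
    rw [hd, hs, submatrix_mul_equiv, submatrix_mul_equiv, ← h.eq]

end IsDiagonalization

lemma Matrix.IsHermitian.isDiagonalization {A : Matrix n n ℂ} (hA : A.IsHermitian) :
    IsDiagonalization A hA.eigenvectorUnitary hA.eigenvalues := by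
  refine ⟨hA.eigenvectorUnitary.2, ?_⟩
  conv_lhs => rw [hA.spectral_theorem, Unitary.conjStarAlgAut_apply]
  rfl

lemma Matrix.PosSemidef.exists_isDiagonalization {A : Matrix n n ℂ} (hA : A.PosSemidef) :
    ∃ (U : Matrix n n ℂ) (a : n → ℝ), IsDiagonalization A U a ∧ ∀ i, 0 ≤ a i :=
  ⟨_, _, hA.1.isDiagonalization, hA.eigenvalues_nonneg⟩

lemma trace_mul_eq_sum_overlap {A B U V : Matrix n n ℂ} {a b : n → ℝ}
    (hA : IsDiagonalization A U a) (hB : IsDiagonalization B V b) :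
    (A * B).trace = ((∑ p : n × n, overlap U V p * (a p.1 * b p.2) : ℝ) : ℂ) := by
  have h1 : (A * B).trace = (diagonal (fun i => (a i : ℂ)) * (star U * V) *
      diagonal (fun i => (b i : ℂ)) * star (star U * V)).trace := by
    rw [hA.eq, hB.eq, star_mul, star_star, mul_assoc U, mul_assoc U, Matrix.trace_mul_comm]
    simp only [mul_assoc]
  rw [h1, Matrix.trace, Fintype.sum_prod_type, Complex.ofReal_sum]
  refine Finset.sum_congr rfl fun i _ => ?_
  rw [diag_apply, mul_apply, Complex.ofReal_sum]
  refine Finset.sum_congr rfl fun j _ => ?_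
  rw [mul_diagonal, diagonal_mul, star_apply, overlap]
  push_cast
  rw [Complex.normSq_eq_conj_mul_self]
  simp only [RCLike.star_def]
  ring

lemma trace_eq_sum_overlap {A U V : Matrix n n ℂ} {a : n → ℝ}
    (hA : IsDiagonalization A U a) (hV : V ∈ Matrix.unitaryGroup n ℂ) :
    A.trace = ((∑ p : n × n, overlap U V p * a p.1 : ℝ) : ℂ) := by
  have h1 : IsDiagonalization (1 : Matrix n n ℂ) V 1 := by
    refine ⟨hV, ?_⟩
    simpa using (Matrix.mem_unitaryGroup_iff.1 hV).symm
  simpa using trace_mul_eq_sum_overlap hA h1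

lemma matPow_eq_hermFun (A : Matrix n n ℂ) (r : ℝ) :
    matPow A r = hermFun (fun x => pinvPow x r) A := rfl

/-- The quasi-entropy `Tr[A^α B^{1-α}]`. -/
def petzQ (α : ℝ) (A B : Matrix n n ℂ) : ℝ := ((matPow A α * matPow B (1 - α)).trace).re

section Pair

variable {A B U V : Matrix n n ℂ} {a b : n → ℝ}

lemma trace_matPow_mul_matPow (hA : IsDiagonalization A U a) (hB : IsDiagonalization B V b)
    (α : ℝ) : (matPow A α * matPow B (1 - α)).trace =
      (quasiSum (overlap U V) (fun p => a p.1) (fun p => b p.2) α : ℂ) :=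
  trace_mul_eq_sum_overlap (hA.hermFun _) (hB.hermFun _)

lemma petzQ_eq_quasiSum (hA : IsDiagonalization A U a) (hB : IsDiagonalization B V b) (α : ℝ) :
    petzQ α A B = quasiSum (overlap U V) (fun p => a p.1) (fun p => b p.2) α := by
  rw [petzQ, trace_matPow_mul_matPow hA hB, Complex.ofReal_re]

lemma suppLE_iff (hA : IsDiagonalization A U a) (hB : IsDiagonalization B V b) :
    suppLE A B ↔ ∀ p : n × n, b p.2 = 0 → overlap U V p * a p.1 = 0 := by
  constructor
  · rintro h ⟨i, j⟩ (hj : b j = 0)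
    have hBv : B *ᵥ (V *ᵥ Pi.single j 1) = 0 := by
      rw [hB.eq, mulVec_mulVec, mul_assoc, hB.star_mul_self, mul_one, ← mulVec_mulVec,
        diagonal_mulVec_single, hj]
      simp
    have h0 := congrArg (fun v => (star U *ᵥ v) i) (h _ hBv)
    have h1 : star U * A = diagonal (fun i => (a i : ℂ)) * star U := by
      rw [hA.eq, mul_assoc, ← mul_assoc, hA.star_mul_self, one_mul]
    simp only [mulVec_mulVec, ← mul_assoc, h1, mulVec_zero, Pi.zero_apply] at h0
    rw [mul_assoc, mulVec_single_one, col_apply, diagonal_mul] at h0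
    simp only [overlap]
    rcases mul_eq_zero.1 h0 with h2 | h2
    · rw [Complex.ofReal_eq_zero.1 h2, mul_zero]
    · rw [h2, map_zero, zero_mul]
  · intro h v hv
    have hb (j : n) : (b j : ℂ) * (star V *ᵥ v) j = 0 := by
      have h0 := congrArg (fun v => (star V *ᵥ v) j) hv
      have h1 : star V * B = diagonal (fun i => (b i : ℂ)) * star V := by
        rw [hB.eq, mul_assoc, ← mul_assoc, hB.star_mul_self, one_mul]
      simpa only [mulVec_mulVec, h1, mulVec_zero, Pi.zero_apply, ← mulVec_mulVec _ _ (star V),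
        mulVec_diagonal] using h0
    have hA' : A *ᵥ v = U *ᵥ ((diagonal (fun i => (a i : ℂ)) * (star U * V)) *ᵥ (star V *ᵥ v)) := by
      simp only [mulVec_mulVec, mul_assoc, hB.mul_star_self, mul_one]
      rw [← mul_assoc, ← hA.eq]
    rw [hA']
    convert mulVec_zero U
    ext i
    rw [mulVec, dotProduct]
    refine Finset.sum_eq_zero fun j _ => ?_
    rw [diagonal_mul]
    rcases mul_eq_zero.1 (hb j) with h1 | h1
    · rcases mul_eq_zero.1 (h (i, j) (Complex.ofReal_eq_zero.1 h1)) with h2 | h2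
      · rw [overlap, Complex.normSq_eq_zero] at h2
        rw [h2, mul_zero, zero_mul]
      · rw [show a i = 0 from h2, Complex.ofReal_zero, zero_mul, zero_mul]
    · rw [h1, mul_zero]

end Pair

end Diagonalization

section Variational

open Matrix

variable {n : Type} [Fintype n] [DecidableEq n]

/-- The quadratic form whose minimum over `Y` is the parallel sum of left multiplication by `A` and
right multiplication by `t B`, evaluated at the identity. -/
def parallelForm (t : ℝ) (A B Y : Matrix n n ℂ) : ℝ :=
  ((star Y * A * Y).trace).re + t * (((1 - Y) * B * star (1 - Y)).trace).re

variable {A B U V : Matrix n n ℂ} {a b : n → ℝ}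

lemma parallelForm_eq_sum (hA : IsDiagonalization A U a) (hB : IsDiagonalization B V b) (t : ℝ)
    (Y : Matrix n n ℂ) :
    parallelForm t A B Y = ∑ p : n × n, (a p.1 * Complex.normSq ((star U * Y * V) p.1 p.2) +
      t * b p.2 * Complex.normSq ((star U * V) p.1 p.2 - (star U * Y * V) p.1 p.2)) := by
  set Z := star U * Y * V with hZ
  set W := star U * V with hW
  have h1 : (star Y * A * Y).trace = (star Z * (diagonal (fun i => (a i : ℂ)) * Z)).trace := by
    rw [hA.eq, hZ, star_mul, star_mul, star_star, mul_assoc (star V), Matrix.trace_mul_comm (star V)]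
    simp only [mul_assoc, hB.mul_star_self, mul_one]
  have hWZ : W - Z = star U * (1 - Y) * V := by rw [hW, hZ, mul_sub, mul_one, sub_mul]
  have h2 : ((1 - Y) * B * star (1 - Y)).trace =
      ((W - Z) * diagonal (fun i => (b i : ℂ)) * star (W - Z)).trace := by
    rw [hB.eq, hWZ, star_mul, star_mul, star_star]
    simp only [mul_assoc]
    rw [Matrix.trace_mul_comm (star U)]
    simp only [mul_assoc, hA.mul_star_self, mul_one]
  rw [parallelForm, h1, h2, Finset.sum_add_distrib]
  congr 1
  · rw [Fintype.sum_prod_type_right, Matrix.trace, Complex.re_sum]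
    refine Finset.sum_congr rfl fun j _ => ?_
    rw [diag_apply, mul_apply, Complex.re_sum]
    refine Finset.sum_congr rfl fun i _ => ?_
    rw [diagonal_mul, star_apply, mul_left_comm, RCLike.star_def,
      ← Complex.normSq_eq_conj_mul_self, ← Complex.ofReal_mul, Complex.ofReal_re]
  · rw [Fintype.sum_prod_type, Matrix.trace, Complex.re_sum, Finset.mul_sum]
    refine Finset.sum_congr rfl fun i _ => ?_
    rw [diag_apply, mul_apply, Complex.re_sum, Finset.mul_sum]
    refine Finset.sum_congr rfl fun j _ => ?_
    rw [mul_diagonal, star_apply, mul_right_comm, RCLike.star_def, Complex.mul_conj,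
      ← Complex.ofReal_mul, Complex.ofReal_re, Matrix.sub_apply]
    ring

lemma parallel_mul_normSq_le {a c : ℝ} (ha : 0 ≤ a) (hc : 0 ≤ c) (w z : ℂ) :
    Complex.normSq w * (c * a / (a + c)) ≤ a * Complex.normSq z + c * Complex.normSq (w - z) := by
  rcases (add_nonneg ha hc).eq_or_lt with h | h
  · rw [← h, div_zero, mul_zero]
    exact add_nonneg (mul_nonneg ha (Complex.normSq_nonneg _))
      (mul_nonneg hc (Complex.normSq_nonneg _))
  · rw [← mul_div_assoc, div_le_iff₀ h]
    simp only [Complex.normSq_apply, Complex.sub_re, Complex.sub_im]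
    nlinarith [sq_nonneg ((a + c) * z.re - c * w.re), sq_nonneg ((a + c) * z.im - c * w.im)]

lemma parallel_mul_normSq_eq {a c : ℝ} (ha : 0 ≤ a) (hc : 0 ≤ c) (w : ℂ) :
    Complex.normSq w * (c * a / (a + c)) = a * Complex.normSq ((c / (a + c) : ℝ) * w) +
      c * Complex.normSq (w - (c / (a + c) : ℝ) * w) := by
  rcases (add_nonneg ha hc).eq_or_lt with h | h
  · have ha0 : a = 0 := by linarith
    have hc0 : c = 0 := by linarith
    simp [ha0, hc0]
  · simp only [Complex.normSq_apply, Complex.sub_re, Complex.sub_im, Complex.re_ofReal_mul,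
      Complex.im_ofReal_mul]
    field_simp
    ring

lemma parallelSum_le_parallelForm (hA : IsDiagonalization A U a) (hB : IsDiagonalization B V b)
    (ha : ∀ i, 0 ≤ a i) (hb : ∀ i, 0 ≤ b i) {t : ℝ} (ht : 0 < t) (Y : Matrix n n ℂ) :
    parallelSum (overlap U V) (fun p => a p.1) (fun p => b p.2) t ≤ parallelForm t A B Y := by
  rw [parallelForm_eq_sum hA hB]
  refine Finset.sum_le_sum fun p _ => ?_
  rw [overlap, mul_right_comm t]
  exact parallel_mul_normSq_le (ha _) (mul_nonneg ht.le (hb _)) _ _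

lemma exists_parallelForm_eq_parallelSum (hA : IsDiagonalization A U a)
    (hB : IsDiagonalization B V b) (ha : ∀ i, 0 ≤ a i) (hb : ∀ i, 0 ≤ b i) {t : ℝ} (ht : 0 < t) :
    ∃ Y, parallelForm t A B Y =
      parallelSum (overlap U V) (fun p => a p.1) (fun p => b p.2) t := by
  let Z : Matrix n n ℂ := fun i j => ((t * b j / (a i + t * b j) : ℝ) : ℂ) * (star U * V) i j
  have hZ : star U * (U * Z * star V) * V = Z := by
    rw [mul_assoc U, ← mul_assoc (star U), hA.star_mul_self, one_mul, mul_assoc,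
      hB.star_mul_self, mul_one]
  refine ⟨U * Z * star V, ?_⟩
  rw [parallelForm_eq_sum hA hB, hZ]
  refine Finset.sum_congr rfl fun p _ => ?_
  rw [mul_right_comm t (a p.1) (b p.2)]
  exact (parallel_mul_normSq_eq (ha _) (mul_nonneg ht.le (hb _)) _).symm

end Variational

section Families

open Matrix

lemma blockDiag_mul_mul_blockDiagonal {K n : Type} [Fintype K] [DecidableEq K] [Fintype n]
    (ρ : Matrix (n × K) (n × K) ℂ) (P Q : K → Matrix n n ℂ) (k : K) :
    blockDiag (blockDiagonal P * ρ * blockDiagonal Q) k = P k * blockDiag ρ k * Q k := by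
  ext i j
  simp [blockDiag_apply, mul_apply, Fintype.sum_prod_type, blockDiagonal_apply]

lemma trace_eq_sum_trace_blockDiag {K n : Type} [Fintype K] [Fintype n]
    (ρ : Matrix (n × K) (n × K) ℂ) : ρ.trace = ∑ k, (blockDiag ρ k).trace := by
  simp only [Matrix.trace, diag_apply, blockDiag_apply, Fintype.sum_prod_type_right]

variable {K L n m : Type} [Fintype K] [Fintype L] [Fintype n] [DecidableEq n] [Fintype m]
  [DecidableEq m] {A B : K → Matrix n n ℂ} {C D : L → Matrix m m ℂ}

lemma sum_petzQ_comparison (hA : ∀ k, (A k).PosSemidef) (hB : ∀ k, (B k).PosSemidef)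
    (hC : ∀ l, (C l).PosSemidef) (hD : ∀ l, (D l).PosSemidef)
    (h : ∀ t (Y : L → Matrix m m ℂ), ∃ Z : K → Matrix n n ℂ,
      ∑ k, parallelForm t (A k) (B k) (Z k) ≤ ∑ l, parallelForm t (C l) (D l) (Y l)) :
    (∀ α ∈ Set.Icc (0 : ℝ) 1, ∑ k, petzQ α (A k) (B k) ≤ ∑ l, petzQ α (C l) (D l)) ∧
      ((∀ k, suppLE (A k) (B k)) → (∀ l, suppLE (C l) (D l)) →
        ∑ k, (A k).trace = ∑ l, (C l).trace →
        ∀ α ∈ Set.Icc (1 : ℝ) 2, ∑ l, petzQ α (C l) (D l) ≤ ∑ k, petzQ α (A k) (B k)) := by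
  choose UA a hUA ha using fun k => (hA k).exists_isDiagonalization
  choose UB b hUB hb using fun k => (hB k).exists_isDiagonalization
  choose UC c hUC hc using fun l => (hC l).exists_isDiagonalization
  choose UD d hUD hd using fun l => (hD l).exists_isDiagonalization
  let w : K × n × n → ℝ := fun q => overlap (UA q.1) (UB q.1) q.2
  let v : L × m × m → ℝ := fun q => overlap (UC q.1) (UD q.1) q.2
  let a' : K × n × n → ℝ := fun q => a q.1 q.2.1
  let b' : K × n × n → ℝ := fun q => b q.1 q.2.2
  let c' : L × m × m → ℝ := fun q => c q.1 q.2.1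
  let d' : L × m × m → ℝ := fun q => d q.1 q.2.2
  have eQ (α : ℝ) : ∑ k, petzQ α (A k) (B k) = quasiSum w a' b' α := by
    rw [quasiSum, Fintype.sum_prod_type]
    exact Finset.sum_congr rfl fun k _ => petzQ_eq_quasiSum (hUA k) (hUB k) α
  have eQ' (α : ℝ) : ∑ l, petzQ α (C l) (D l) = quasiSum v c' d' α := by
    rw [quasiSum, Fintype.sum_prod_type]
    exact Finset.sum_congr rfl fun l _ => petzQ_eq_quasiSum (hUC l) (hUD l) α
  have key (t : ℝ) (ht : 0 < t) : parallelSum w a' b' t ≤ parallelSum v c' d' t := by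
    choose Y hY using fun l =>
      exists_parallelForm_eq_parallelSum (hUC l) (hUD l) (hc l) (hd l) ht
    obtain ⟨Z, hZ⟩ := h t Y
    rw [parallelSum, Fintype.sum_prod_type, parallelSum, Fintype.sum_prod_type]
    calc _ ≤ ∑ k, parallelForm t (A k) (B k) (Z k) := Finset.sum_le_sum fun k _ =>
          parallelSum_le_parallelForm (hUA k) (hUB k) (ha k) (hb k) ht (Z k)
      _ ≤ ∑ l, parallelForm t (C l) (D l) (Y l) := hZ
      _ = _ := Finset.sum_congr rfl fun l _ => hY l
  refine ⟨fun α hα => ?_, fun hs hs' htr α hα => ?_⟩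
  · rw [eQ, eQ']
    exact quasiSum_le_of_parallelSum_le (fun q : K × n × n => ha q.1 q.2.1) (fun q : K × n × n => hb q.1 q.2.2)
      (fun q : L × m × m => hc q.1 q.2.1) (fun q : L × m × m => hd q.1 q.2.2) key hα
  · rw [eQ, eQ']
    refine quasiSum_ge_of_parallelSum_le (fun q : K × n × n => ha q.1 q.2.1) (fun q : K × n × n => hb q.1 q.2.2)
      (fun q : L × m × m => hc q.1 q.2.1) (fun q : L × m × m => hd q.1 q.2.2)
      (fun q : K × n × n => (suppLE_iff (hUA q.1) (hUB q.1)).1 (hs q.1) q.2)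
      (fun q : L × m × m => (suppLE_iff (hUC q.1) (hUD q.1)).1 (hs' q.1) q.2) ?_ key hα
    rw [Fintype.sum_prod_type, Fintype.sum_prod_type]
    rw [Finset.sum_congr rfl fun k _ => trace_eq_sum_overlap (hUA k) (hUB k).unitary,
      Finset.sum_congr rfl fun l _ => trace_eq_sum_overlap (hUC l) (hUD l).unitary,
      ← Complex.ofReal_sum, ← Complex.ofReal_sum] at htr
    exact Complex.ofReal_injective htr

lemma sum_parallelForm (t : ℝ) (Y : Matrix n n ℂ) :
    ∑ k, parallelForm t (A k) (B k) Y = parallelForm t (∑ k, A k) (∑ k, B k) Y := by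
  rw [parallelForm, Matrix.mul_sum, Matrix.sum_mul, Matrix.mul_sum, Matrix.sum_mul,
    Matrix.trace_sum, Matrix.trace_sum, Complex.re_sum, Complex.re_sum, Finset.mul_sum,
    ← Finset.sum_add_distrib]
  rfl

lemma sum_petzQ_le_petzQ_sum (hA : ∀ k, (A k).PosSemidef) (hB : ∀ k, (B k).PosSemidef) :
    (∀ α ∈ Set.Icc (0 : ℝ) 1, ∑ k, petzQ α (A k) (B k) ≤ petzQ α (∑ k, A k) (∑ k, B k)) ∧
      ((∀ k, suppLE (A k) (B k)) → suppLE (∑ k, A k) (∑ k, B k) →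
        ∀ α ∈ Set.Icc (1 : ℝ) 2,
          petzQ α (∑ k, A k) (∑ k, B k) ≤ ∑ k, petzQ α (A k) (B k)) := by
  have h := sum_petzQ_comparison (L := Unit) (C := fun _ => ∑ k, A k) (D := fun _ => ∑ k, B k)
    hA hB (fun _ => posSemidef_sum _ fun k _ => hA k) (fun _ => posSemidef_sum _ fun k _ => hB k)
    fun t Y => ⟨fun _ => Y (), by simp [sum_parallelForm]⟩
  simp only [Finset.univ_unique, Finset.sum_singleton] at h
  exact ⟨h.1, fun h₁ h₂ => h.2 h₁ (fun _ => h₂) (Matrix.trace_sum _ _).symm⟩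

lemma parallelForm_blockDiagonal [DecidableEq K] (t : ℝ) (ρ σ : Matrix (n × K) (n × K) ℂ)
    (Y : K → Matrix n n ℂ) :
    parallelForm t ρ σ (blockDiagonal Y) =
      ∑ k, parallelForm t (blockDiag ρ k) (blockDiag σ k) (Y k) := by
  have h1 : (1 : Matrix (n × K) (n × K) ℂ) - blockDiagonal Y =
      blockDiagonal fun k => 1 - Y k := by
    rw [← blockDiagonal_one, ← blockDiagonal_sub]
    rfl
  rw [parallelForm, h1, star_eq_conjTranspose, star_eq_conjTranspose, blockDiagonal_conjTranspose,
    blockDiagonal_conjTranspose, trace_eq_sum_trace_blockDiag,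
    trace_eq_sum_trace_blockDiag (_ * σ * _)]
  simp only [blockDiag_mul_mul_blockDiagonal, Complex.re_sum, Finset.mul_sum,
    ← Finset.sum_add_distrib]
  rfl

lemma petzQ_le_sum_petzQ_blockDiag [DecidableEq K] {ρ σ : Matrix (n × K) (n × K) ℂ}
    (hρ : ρ.PosSemidef) (hσ : σ.PosSemidef) :
    (∀ α ∈ Set.Icc (0 : ℝ) 1, petzQ α ρ σ ≤ ∑ k, petzQ α (blockDiag ρ k) (blockDiag σ k)) ∧
      (suppLE ρ σ → (∀ k, suppLE (blockDiag ρ k) (blockDiag σ k)) →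
        ∀ α ∈ Set.Icc (1 : ℝ) 2,
          ∑ k, petzQ α (blockDiag ρ k) (blockDiag σ k) ≤ petzQ α ρ σ) := by
  have h := sum_petzQ_comparison (K := Unit) (A := fun _ => ρ) (B := fun _ => σ)
    (C := blockDiag ρ) (D := blockDiag σ)
    (fun _ => hρ) (fun _ => hσ) (fun k => hρ.submatrix _) (fun k => hσ.submatrix _)
    fun t Y => ⟨fun _ => blockDiagonal Y, by simp [parallelForm_blockDiagonal]⟩
  simp only [Finset.univ_unique, Finset.sum_singleton] at h
  exact ⟨h.1, fun h₁ h₂ => h.2 (fun _ => h₁) h₂ (trace_eq_sum_trace_blockDiag _)⟩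

end Families

section Support

open Matrix
open scoped Kronecker

variable {n m K : Type} [Fintype n] [Fintype m] [Fintype K]

lemma suppLE_sum {A B : K → Matrix n n ℂ} (hB : ∀ k, (B k).PosSemidef)
    (h : ∀ k, suppLE (A k) (B k)) : suppLE (∑ k, A k) (∑ k, B k) := by
  intro v hv
  have h0 : ∑ k, star v ⬝ᵥ (B k *ᵥ v) = 0 := by
    rw [← dotProduct_sum, ← sum_mulVec, hv, dotProduct_zero]
  have h1 := (Finset.sum_eq_zero_iff_of_nonneg fun k _ => (hB k).dotProduct_mulVec_nonneg v).1 h0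
  rw [sum_mulVec]
  exact Finset.sum_eq_zero fun k hk =>
    h k v (((hB k).dotProduct_mulVec_zero_iff v).1 (h1 k hk))

lemma suppLE_blockDiag [DecidableEq K] {ρ σ : Matrix (n × K) (n × K) ℂ} (hσ : σ.PosSemidef)
    (h : suppLE ρ σ) (k : K) : suppLE (blockDiag ρ k) (blockDiag σ k) := by
  intro v hv
  let u : n × K → ℂ := fun p => if p.2 = k then v p.1 else 0
  have hu (τ : Matrix (n × K) (n × K) ℂ) (i : n) : (τ *ᵥ u) (i, k) = (blockDiag τ k *ᵥ v) i := by
    simp [mulVec, dotProduct, Fintype.sum_prod_type, blockDiag_apply, u]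
  have h0 : star u ⬝ᵥ (σ *ᵥ u) = 0 := by
    rw [dotProduct, Fintype.sum_prod_type]
    refine Finset.sum_eq_zero fun i _ => Finset.sum_eq_zero fun l _ => ?_
    by_cases hl : l = k
    · rw [hl, hu, hv, Pi.zero_apply, mul_zero]
    · simp [u, hl]
  ext i
  rw [← hu, h u ((hσ.dotProduct_mulVec_zero_iff u).1 h0)]
  rfl

lemma suppLE_submatrix {A B : Matrix n n ℂ} (e : m ≃ n) :
    suppLE (A.submatrix e e) (B.submatrix e e) ↔ suppLE A B := by
  have h0 (C : Matrix n n ℂ) (v : n → ℂ) : C.submatrix e e *ᵥ (v ∘ e) = (C *ᵥ v) ∘ e := by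
    rw [submatrix_mulVec_equiv, Function.comp_assoc, e.self_comp_symm, Function.comp_id]
  constructor
  · intro h v hv
    have h1 := h (v ∘ e) (by rw [h0, hv]; rfl)
    rw [h0] at h1
    exact e.surjective.injective_comp_right h1
  · intro h v hv
    obtain ⟨u, rfl⟩ : ∃ u, v = u ∘ e := ⟨v ∘ e.symm, by simp [Function.comp_assoc]⟩
    rw [h0] at hv ⊢
    rw [h u (e.surjective.injective_comp_right hv)]
    rfl

lemma overlap_kronecker (U V : Matrix n n ℂ) (W Z : Matrix m m ℂ) (p : (n × m) × n × m) :
    overlap (U ⊗ₖ W) (V ⊗ₖ Z) p =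
      overlap U V (p.1.1, p.2.1) * overlap W Z (p.1.2, p.2.2) := by
  rw [overlap, star_eq_conjTranspose, conjTranspose_kronecker, ← mul_kronecker_mul,
    kroneckerMap_apply, map_mul]
  rfl

variable [DecidableEq n] [DecidableEq m]

lemma suppLE_kronecker {A B : Matrix n n ℂ} {C D : Matrix m m ℂ} (hA : A.PosSemidef)
    (hB : B.PosSemidef) (hC : C.PosSemidef) (hD : D.PosSemidef) (h : suppLE A B)
    (h' : suppLE C D) : suppLE (A ⊗ₖ C) (B ⊗ₖ D) := by
  obtain ⟨U, a, hU, -⟩ := hA.exists_isDiagonalization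
  obtain ⟨V, b, hV, -⟩ := hB.exists_isDiagonalization
  obtain ⟨W, c, hW, -⟩ := hC.exists_isDiagonalization
  obtain ⟨Z, d, hZ, -⟩ := hD.exists_isDiagonalization
  rw [suppLE_iff hU hV] at h
  rw [suppLE_iff hW hZ] at h'
  rw [suppLE_iff (hU.kronecker hW) (hV.kronecker hZ)]
  intro p hp
  rw [overlap_kronecker, mul_mul_mul_comm]
  rcases mul_eq_zero.1 hp with h0 | h0
  · rw [h (p.1.1, p.2.1) h0, zero_mul]
  · rw [h' (p.1.2, p.2.2) h0, mul_zero]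

end Support

section QuasiEntropy

open Matrix
open scoped Kronecker

variable {n m : Type} [Fintype n] [DecidableEq n] [Fintype m] [DecidableEq m]
  {A B : Matrix n n ℂ} {C D : Matrix m m ℂ}

lemma petzQ_nonneg (hA : A.PosSemidef) (hB : B.PosSemidef) (α : ℝ) : 0 ≤ petzQ α A B := by
  obtain ⟨U, a, hU, ha⟩ := hA.exists_isDiagonalization
  obtain ⟨V, b, hV, hb⟩ := hB.exists_isDiagonalization
  rw [petzQ_eq_quasiSum hU hV]
  exact quasiSum_nonneg (overlap_nonneg U V) (fun p => ha p.1) (fun p => hb p.2) α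

lemma petzQ_pos (hA : A.PosSemidef) (hB : B.PosSemidef) (h : suppLE A B) (h0 : A.trace ≠ 0)
    (α : ℝ) : 0 < petzQ α A B := by
  obtain ⟨U, a, hU, ha⟩ := hA.exists_isDiagonalization
  obtain ⟨V, b, hV, hb⟩ := hB.exists_isDiagonalization
  rw [petzQ_eq_quasiSum hU hV]
  refine quasiSum_pos (overlap_nonneg U V) (fun p => ha p.1) (fun p => hb p.2)
    ((suppLE_iff hU hV).1 h) ?_ α
  rwa [trace_eq_sum_overlap hU hV.unitary, Complex.ofReal_ne_zero] at h0

lemma petzQ_eq_zero_iff (hA : A.PosSemidef) (hB : B.PosSemidef) (α : ℝ) :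
    petzQ α A B = 0 ↔ (A * B).trace = 0 := by
  obtain ⟨U, a, hU, ha⟩ := hA.exists_isDiagonalization
  obtain ⟨V, b, hV, hb⟩ := hB.exists_isDiagonalization
  rw [petzQ_eq_quasiSum hU hV, trace_mul_eq_sum_overlap hU hV, Complex.ofReal_eq_zero,
    quasiSum_eq_zero_iff (overlap_nonneg U V) (fun p => ha p.1) (fun p => hb p.2)]

lemma matPow_kronecker (hA : A.PosSemidef) (hC : C.PosSemidef) (r : ℝ) :
    matPow (A ⊗ₖ C) r = matPow A r ⊗ₖ matPow C r := by
  obtain ⟨U, a, hU, ha⟩ := hA.exists_isDiagonalization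
  obtain ⟨W, c, hW, hc⟩ := hC.exists_isDiagonalization
  simp only [matPow_eq_hermFun]
  rw [((hU.hermFun _).kronecker (hW.hermFun _)).eq, (hU.kronecker hW).hermFun_eq]
  simp only [pinvPow_mul (ha _) (hc _)]

lemma petzQ_kronecker (hA : A.PosSemidef) (hB : B.PosSemidef) (hC : C.PosSemidef)
    (hD : D.PosSemidef) (α : ℝ) :
    petzQ α (A ⊗ₖ C) (B ⊗ₖ D) = petzQ α A B * petzQ α C D := by
  obtain ⟨U, a, hU, ha⟩ := hA.exists_isDiagonalization
  obtain ⟨V, b, hV, hb⟩ := hB.exists_isDiagonalization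
  rw [petzQ, matPow_kronecker hA hC, matPow_kronecker hB hD, ← mul_kronecker_mul, trace_kronecker,
    petzQ, petzQ, trace_matPow_mul_matPow hU hV, Complex.re_ofReal_mul, Complex.ofReal_re]

lemma matPow_one (hA : A.IsHermitian) : matPow A 1 = A := by
  conv_rhs => rw [hA.isDiagonalization.eq]
  rw [matPow_eq_hermFun, hA.isDiagonalization.hermFun_eq]
  simp only [pinvPow_one_right]

lemma suppProj_eq_matPow_zero (A : Matrix n n ℂ) : suppProj A = matPow A 0 := by
  simp only [suppProj, matPow, Real.rpow_eq_pow, Real.rpow_zero]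

namespace IsDiagonalization

lemma mul {A C U : Matrix n n ℂ} {a c : n → ℝ} (h : IsDiagonalization A U a)
    (h' : IsDiagonalization C U c) : IsDiagonalization (A * C) U (fun i => a i * c i) := by
  refine ⟨h.unitary, ?_⟩
  have hd : (diagonal fun i => ((a i * c i : ℝ) : ℂ)) =
      diagonal (fun i => (a i : ℂ)) * diagonal (fun i => (c i : ℂ)) := by
    simp
  rw [hd, h.eq, h'.eq]
  simp only [mul_assoc]
  rw [← mul_assoc (star U) U, h.star_mul_self, one_mul]

end IsDiagonalization

lemma matPow_mul_matPow_one_sub (hA : A.PosSemidef) (α : ℝ) :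
    matPow A α * matPow A (1 - α) = A := by
  obtain ⟨U, a, hU, ha⟩ := hA.exists_isDiagonalization
  simp only [matPow_eq_hermFun]
  rw [((hU.hermFun _).mul (hU.hermFun _)).eq]
  conv_rhs => rw [hU.eq]
  congr 3
  funext i
  rcases (ha i).eq_or_lt with h | h
  · simp [← h, pinvPow_zero_left]
  · rw [pinvPow_of_ne h.ne', pinvPow_of_ne h.ne', ← Real.rpow_add h, add_sub_cancel,
      Real.rpow_one]

lemma hermFun_submatrix (hA : A.IsHermitian) (f : ℝ → ℝ) (e : m ≃ n) :
    hermFun f (A.submatrix e e) = (hermFun f A).submatrix e e := by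
  rw [(hA.isDiagonalization.submatrix e).hermFun_eq,
    ((hA.isDiagonalization.hermFun f).submatrix e).eq]

end QuasiEntropy

section Renyi

open Matrix Filter Topology

lemma trace_submatrix_equiv {n m : Type} [Fintype n] [Fintype m] (M : Matrix n n ℂ) (e : m ≃ n) :
    (M.submatrix e e).trace = M.trace :=
  Equiv.sum_comp e fun i => M i i

variable {n m : Type} [Fintype n] [DecidableEq n] [Fintype m] [DecidableEq m]
  {A B : Matrix n n ℂ}

lemma petzRenyi_submatrix (hA : A.IsHermitian) (hB : B.IsHermitian) (e : m ≃ n) (α : ℝ) :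
    petzRenyi α (A.submatrix e e) (B.submatrix e e) = petzRenyi α A B := by
  have hsub (M N : Matrix n n ℂ) :
      M.submatrix e e - N.submatrix e e = (M - N).submatrix e e := rfl
  simp only [petzRenyi, relEnt, suppProj, matLog2, matPow, hermFun_submatrix hA,
    hermFun_submatrix hB, suppLE_submatrix, submatrix_mul_equiv, hsub,
    trace_submatrix_equiv]

/-- The real value of the Petz–Rényi divergence when it is finite and `α ≠ 1`. -/
def renyiReal (α : ℝ) (A B : Matrix n n ℂ) : ℝ := (α - 1)⁻¹ * Real.logb 2 (petzQ α A B)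

lemma petzRenyi_of_lt_one (hA : A.PosSemidef) (hB : B.PosSemidef) {α : ℝ} (h1 : α < 1) :
    petzRenyi α A B = if petzQ α A B = 0 then ⊤ else (renyiReal α A B : EReal) := by
  rw [petzRenyi, if_neg h1.ne]
  rcases eq_or_ne α 0 with rfl | h0
  · have hq : ((suppProj A * B).trace).re = petzQ 0 A B := by
      rw [petzQ, sub_zero, matPow_one hB.1, suppProj_eq_matPow_zero]
    rw [if_pos rfl, hq, negLog2, renyiReal]
    simp only [(petzQ_nonneg hA hB 0).ge_iff_eq']
    norm_num
  · rw [if_neg h0, if_neg fun h => h1.not_gt h.1]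
    simp only [petzQ_eq_zero_iff hA hB, h1, true_and]
    rfl

lemma petzRenyi_of_one_lt {α : ℝ} (h1 : 1 < α) :
    petzRenyi α A B = if suppLE A B then (renyiReal α A B : EReal) else ⊤ := by
  rw [petzRenyi, if_neg (zero_lt_one.trans h1).ne', if_neg h1.ne']
  by_cases h : suppLE A B
  · rw [if_neg fun h' => h'.2 h, if_neg fun h' => h1.not_gt h'.1, if_pos h]
    rfl
  · rw [if_pos ⟨h1, h⟩, if_neg h]

lemma petzRenyi_one : petzRenyi 1 A B = relEnt A B := by
  rw [petzRenyi, if_neg one_ne_zero, if_pos rfl]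

lemma petzRenyi_self (hA : IsDensity A) {α : ℝ} : petzRenyi α A A = 0 := by
  have hq : petzQ α A A = 1 := by
    rw [petzQ, matPow_mul_matPow_one_sub hA.1, hA.2, Complex.one_re]
  have h0 : renyiReal α A A = 0 := by rw [renyiReal, hq, Real.logb_one, mul_zero]
  have hs : suppLE A A := fun _ => id
  rcases lt_trichotomy α 1 with h | rfl | h
  · rw [petzRenyi_of_lt_one hA.1 hA.1 h, hq, if_neg one_ne_zero, h0, EReal.coe_zero]
  · rw [petzRenyi_one, relEnt, if_pos hs, sub_self, mul_zero, Matrix.trace_zero, Complex.zero_re,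
      EReal.coe_zero]
  · rw [petzRenyi_of_one_lt h, if_pos hs, h0, EReal.coe_zero]

lemma hasDerivAt_quasiSum_one {I : Type} [Fintype I] {w a b : I → ℝ} (ha : ∀ i, 0 ≤ a i)
    (hb : ∀ i, 0 ≤ b i) (hs : ∀ i, b i = 0 → w i * a i = 0) :
    HasDerivAt (quasiSum w a b)
      (∑ i, w i * (a i * Real.log (a i) - a i * Real.log (b i))) 1 := by
  unfold quasiSum
  refine HasDerivAt.fun_sum fun i _ => ?_
  by_cases hwa : w i * a i = 0
  · rcases mul_eq_zero.1 hwa with h | h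
    · simpa [h] using hasDerivAt_const (1 : ℝ) (0 : ℝ)
    · simpa [h, pinvPow_zero_left] using hasDerivAt_const (1 : ℝ) (0 : ℝ)
  · have hai : 0 < a i := (ha i).lt_of_ne' (right_ne_zero_of_mul hwa)
    have hbi : 0 < b i := (hb i).lt_of_ne' fun h => hwa (hs i h)
    simp only [pinvPow_of_ne hai.ne', pinvPow_of_ne hbi.ne']
    have h1 := (Real.hasStrictDerivAt_const_rpow hai 1).hasDerivAt
    have h2 := ((Real.hasStrictDerivAt_const_rpow hbi (1 - 1)).hasDerivAt).comp (1 : ℝ)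
      ((hasDerivAt_id (1 : ℝ)).const_sub 1)
    refine ((h1.mul h2).const_mul (w i)).congr_deriv ?_
    simp only [sub_self, Real.rpow_zero, Real.rpow_one, Function.comp_apply]
    ring

lemma matLog2_eq (A : Matrix n n ℂ) : matLog2 A = hermFun (Real.logb 2) A := by
  rw [matLog2]
  congr 1
  funext x
  split_ifs with h
  · rw [h, Real.logb_zero]
  · rfl

lemma tendsto_renyiReal (hA : IsDensity A) (hB : B.PosSemidef) (h : suppLE A B) :
    Tendsto (fun α => renyiReal α A B) (𝓝[<] 1)
      (𝓝 ((A * (matLog2 A - matLog2 B)).trace).re) := by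
  obtain ⟨U, a, hU, ha⟩ := hA.1.exists_isDiagonalization
  obtain ⟨V, b, hV, hb⟩ := hB.exists_isDiagonalization
  have hs := (suppLE_iff hU hV).1 h
  have htr : ∑ p : n × n, overlap U V p * a p.1 = 1 := by
    have h1 := trace_eq_sum_overlap hU hV.unitary
    rw [hA.2] at h1
    exact_mod_cast h1.symm
  have hq1 : quasiSum (overlap U V) (fun p => a p.1) (fun p => b p.2) 1 = 1 := by
    rw [quasiSum_one hs, htr]
  have hd := (hasDerivAt_quasiSum_one (fun p : n × n => ha p.1) (fun p : n × n => hb p.2) hs).log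
    (by rw [hq1]; exact one_ne_zero)
  have hlt : 𝓝[<] (1 : ℝ) ≤ 𝓝[≠] 1 := nhdsWithin_mono 1 fun _ h => ne_of_lt h
  have hd' := (hd.div_const (Real.log 2)).tendsto_slope.mono_left hlt
  rw [hq1, div_one] at hd'
  convert hd' using 2
  · rw [slope_def_field, hq1, Real.log_one, zero_div, sub_zero, renyiReal,
      petzQ_eq_quasiSum hU hV, Real.logb, div_eq_inv_mul (_ / _)]
  · rw [mul_sub, Matrix.trace_sub, matLog2_eq, matLog2_eq,
      trace_eq_sum_overlap (hU.mul (hU.hermFun _)) hV.unitary,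
      trace_mul_eq_sum_overlap hU (hV.hermFun _), ← Complex.ofReal_sub, Complex.ofReal_re,
      ← Finset.sum_sub_distrib, Finset.sum_div]
    refine Finset.sum_congr rfl fun p _ => ?_
    simp only [Real.logb]
    ring

end Renyi
section Channel

open Matrix Filter Topology
open scoped Kronecker

variable {R X B : Type} [Fintype R] [Fintype X] [Fintype B] {ν μ : X → Matrix B B ℂ}
  {ρ σ : Matrix (R × X) (R × X) ℂ}

lemma idTensor_cqChannel {R X B : Type} [Fintype X] [Fintype B] (ν : X → Matrix B B ℂ)
    (ρ : Matrix (R × X) (R × X) ℂ) :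
    idTensor (cqChannel ν) ρ = ∑ x, blockDiag ρ x ⊗ₖ ν x := by
  ext p q
  simp [idTensor, cqChannel, Matrix.sum_apply, blockDiag_apply, kroneckerMap_apply]

lemma trace_idTensor_cqChannel (hν : ∀ x, (ν x).trace = 1) (ρ : Matrix (R × X) (R × X) ℂ) :
    (idTensor (cqChannel ν) ρ).trace = ρ.trace := by
  rw [idTensor_cqChannel, Matrix.trace_sum, trace_eq_sum_trace_blockDiag]
  simp only [trace_kronecker, hν, mul_one]

lemma posSemidef_idTensor_cqChannel (hν : ∀ x, (ν x).PosSemidef) (hρ : ρ.PosSemidef) :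
    (idTensor (cqChannel ν) ρ).PosSemidef := by
  rw [idTensor_cqChannel]
  exact posSemidef_sum _ fun x _ => (hρ.submatrix _).kronecker (hν x)

lemma isDensity_idTensor_cqChannel (hν : ∀ x, IsDensity (ν x)) (hρ : IsDensity ρ) :
    IsDensity (idTensor (cqChannel ν) ρ) :=
  ⟨posSemidef_idTensor_cqChannel (fun x => (hν x).1) hρ.1,
    (trace_idTensor_cqChannel (fun x => (hν x).2) ρ).trans hρ.2⟩

variable [DecidableEq R] [DecidableEq B] [DecidableEq X]

lemma suppLE_idTensor_cqChannel (hν : ∀ x, (ν x).PosSemidef) (hμ : ∀ x, (μ x).PosSemidef)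
    (hρ : ρ.PosSemidef) (hσ : σ.PosSemidef) (hs : ∀ x, suppLE (ν x) (μ x)) (h : suppLE ρ σ) :
    suppLE (idTensor (cqChannel ν) ρ) (idTensor (cqChannel μ) σ) := by
  rw [idTensor_cqChannel, idTensor_cqChannel]
  exact suppLE_sum (fun x => PosSemidef.kronecker (hσ.submatrix _) (hμ x)) fun x =>
    suppLE_kronecker (hρ.submatrix _) (hσ.submatrix _) (hν x) (hμ x)
      (suppLE_blockDiag hσ h x) (hs x)

variable [Nonempty X]

lemma exists_petzQ_mul_petzQ_le (hν : ∀ x, (ν x).PosSemidef) (hμ : ∀ x, (μ x).PosSemidef)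
    (hρ : ρ.PosSemidef) (hσ : σ.PosSemidef) {α : ℝ} (hα : α ∈ Set.Icc (0 : ℝ) 1) :
    ∃ x, petzQ α (ν x) (μ x) * petzQ α ρ σ ≤
      petzQ α (idTensor (cqChannel ν) ρ) (idTensor (cqChannel μ) σ) := by
  obtain ⟨x, hx⟩ := Finite.exists_min fun x => petzQ α (ν x) (μ x)
  refine ⟨x, ?_⟩
  have hρ' (k : X) : (blockDiag ρ k).PosSemidef := hρ.submatrix _
  have hσ' (k : X) : (blockDiag σ k).PosSemidef := hσ.submatrix _
  calc petzQ α (ν x) (μ x) * petzQ α ρ σ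
      ≤ petzQ α (ν x) (μ x) * ∑ k, petzQ α (blockDiag ρ k) (blockDiag σ k) :=
        mul_le_mul_of_nonneg_left ((petzQ_le_sum_petzQ_blockDiag hρ hσ).1 α hα)
          (petzQ_nonneg (hν x) (hμ x) α)
    _ ≤ ∑ k, petzQ α (blockDiag ρ k ⊗ₖ ν k) (blockDiag σ k ⊗ₖ μ k) := by
        rw [Finset.mul_sum]
        refine Finset.sum_le_sum fun k _ => ?_
        rw [petzQ_kronecker (hρ' k) (hσ' k) (hν k) (hμ k), mul_comm]
        exact mul_le_mul_of_nonneg_left (hx k) (petzQ_nonneg (hρ' k) (hσ' k) α)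
    _ ≤ petzQ α (idTensor (cqChannel ν) ρ) (idTensor (cqChannel μ) σ) := by
        rw [idTensor_cqChannel, idTensor_cqChannel]
        exact (sum_petzQ_le_petzQ_sum (fun k => (hρ' k).kronecker (hν k))
          fun k => (hσ' k).kronecker (hμ k)).1 α hα

lemma exists_le_petzQ_mul_petzQ (hν : ∀ x, (ν x).PosSemidef) (hμ : ∀ x, (μ x).PosSemidef)
    (hρ : ρ.PosSemidef) (hσ : σ.PosSemidef) (hs : ∀ x, suppLE (ν x) (μ x)) (h : suppLE ρ σ)
    {α : ℝ} (hα : α ∈ Set.Icc (1 : ℝ) 2) :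
    ∃ x, petzQ α (idTensor (cqChannel ν) ρ) (idTensor (cqChannel μ) σ) ≤
      petzQ α (ν x) (μ x) * petzQ α ρ σ := by
  obtain ⟨x, hx⟩ := Finite.exists_max fun x => petzQ α (ν x) (μ x)
  refine ⟨x, ?_⟩
  have hρ' (k : X) : (blockDiag ρ k).PosSemidef := hρ.submatrix _
  have hσ' (k : X) : (blockDiag σ k).PosSemidef := hσ.submatrix _
  have hsupp (k : X) := suppLE_blockDiag hσ h k
  calc petzQ α (idTensor (cqChannel ν) ρ) (idTensor (cqChannel μ) σ)
      ≤ ∑ k, petzQ α (blockDiag ρ k ⊗ₖ ν k) (blockDiag σ k ⊗ₖ μ k) := by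
        have hs' := suppLE_idTensor_cqChannel hν hμ hρ hσ hs h
        rw [idTensor_cqChannel, idTensor_cqChannel] at hs' ⊢
        exact (sum_petzQ_le_petzQ_sum (fun k => (hρ' k).kronecker (hν k))
          fun k => (hσ' k).kronecker (hμ k)).2 (fun k => suppLE_kronecker (hρ' k) (hσ' k) (hν k)
            (hμ k) (hsupp k) (hs k)) hs' α hα
    _ ≤ petzQ α (ν x) (μ x) * ∑ k, petzQ α (blockDiag ρ k) (blockDiag σ k) := by
        rw [Finset.mul_sum]
        refine Finset.sum_le_sum fun k _ => ?_
        rw [petzQ_kronecker (hρ' k) (hσ' k) (hν k) (hμ k), mul_comm]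
        exact mul_le_mul_of_nonneg_right (hx k) (petzQ_nonneg (hρ' k) (hσ' k) α)
    _ ≤ petzQ α (ν x) (μ x) * petzQ α ρ σ :=
        mul_le_mul_of_nonneg_left ((petzQ_le_sum_petzQ_blockDiag hρ hσ).2 h hsupp α hα)
          (petzQ_nonneg (hν x) (hμ x) α)

lemma exists_renyiReal_le_add_of_lt_one (hν : ∀ x, (ν x).PosSemidef)
    (hμ : ∀ x, (μ x).PosSemidef) (hρ : ρ.PosSemidef) (hσ : σ.PosSemidef) {α : ℝ} (h0 : 0 ≤ α)
    (h1 : α < 1) (hq : ∀ x, petzQ α (ν x) (μ x) ≠ 0) (hQ : petzQ α ρ σ ≠ 0) :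
    petzQ α (idTensor (cqChannel ν) ρ) (idTensor (cqChannel μ) σ) ≠ 0 ∧
      ∃ x, renyiReal α (idTensor (cqChannel ν) ρ) (idTensor (cqChannel μ) σ) ≤
        renyiReal α (ν x) (μ x) + renyiReal α ρ σ := by
  obtain ⟨x, hx⟩ := exists_petzQ_mul_petzQ_le hν hμ hρ hσ ⟨h0, h1.le⟩
  have hpos := mul_pos ((petzQ_nonneg (hν x) (hμ x) α).lt_of_ne' (hq x))
    ((petzQ_nonneg hρ hσ α).lt_of_ne' hQ)
  refine ⟨(hpos.trans_le hx).ne', x, ?_⟩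
  simp only [renyiReal]
  rw [← mul_add, ← Real.logb_mul (hq x) hQ]
  exact mul_le_mul_of_nonpos_left (Real.logb_le_logb_of_le one_lt_two hpos hx)
    (inv_nonpos.2 (sub_nonpos.2 h1.le))

lemma exists_renyiReal_le_add_of_one_lt (hν : ∀ x, IsDensity (ν x)) (hμ : ∀ x, IsDensity (μ x))
    (hρ : IsDensity ρ) (hσ : IsDensity σ) (hs : ∀ x, suppLE (ν x) (μ x)) (h : suppLE ρ σ)
    {α : ℝ} (h1 : 1 < α) (h2 : α ≤ 2) :
    ∃ x, renyiReal α (idTensor (cqChannel ν) ρ) (idTensor (cqChannel μ) σ) ≤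
      renyiReal α (ν x) (μ x) + renyiReal α ρ σ := by
  have hν' (x : X) := (hν x).1
  have hμ' (x : X) := (hμ x).1
  obtain ⟨x, hx⟩ := exists_le_petzQ_mul_petzQ hν' hμ' hρ.1 hσ.1 hs h ⟨h1.le, h2⟩
  refine ⟨x, ?_⟩
  have hpos : 0 < petzQ α (idTensor (cqChannel ν) ρ) (idTensor (cqChannel μ) σ) := by
    refine petzQ_pos (posSemidef_idTensor_cqChannel hν' hρ.1)
      (posSemidef_idTensor_cqChannel hμ' hσ.1)
      (suppLE_idTensor_cqChannel hν' hμ' hρ.1 hσ.1 hs h) ?_ α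
    rw [trace_idTensor_cqChannel fun x => (hν x).2, hρ.2]
    exact one_ne_zero
  have hne := (hpos.trans_le hx).ne'
  simp only [renyiReal]
  rw [← mul_add, ← Real.logb_mul (left_ne_zero_of_mul hne) (right_ne_zero_of_mul hne)]
  exact mul_le_mul_of_nonneg_left (Real.logb_le_logb_of_le one_lt_two hpos hx)
    (inv_nonneg.2 (sub_nonneg.2 h1.le))

lemma exists_relEnt_le_add (hν : ∀ x, IsDensity (ν x)) (hμ : ∀ x, IsDensity (μ x))
    (hρ : IsDensity ρ) (hσ : IsDensity σ) (hs : ∀ x, suppLE (ν x) (μ x)) (h : suppLE ρ σ) :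
    ∃ x, relEnt (idTensor (cqChannel ν) ρ) (idTensor (cqChannel μ) σ) ≤
      relEnt (ν x) (μ x) + relEnt ρ σ := by
  have hν' (x : X) := (hν x).1
  have hμ' (x : X) := (hμ x).1
  have hs' := suppLE_idTensor_cqChannel hν' hμ' hρ.1 hσ.1 hs h
  by_contra! hcon
  simp only [relEnt, if_pos hs', if_pos h, if_pos (hs _), ← EReal.coe_add,
    EReal.coe_lt_coe_iff] at hcon
  have hout := tendsto_renyiReal (isDensity_idTensor_cqChannel hν hρ)
    (isDensity_idTensor_cqChannel hμ hσ).1 hs'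
  have hev : ∀ᶠ α in 𝓝[<] (1 : ℝ), ∀ x, renyiReal α (ν x) (μ x) + renyiReal α ρ σ <
      renyiReal α (idTensor (cqChannel ν) ρ) (idTensor (cqChannel μ) σ) :=
    eventually_all.2 fun x => ((tendsto_renyiReal (hν x) (hμ' x) (hs x)).add
      (tendsto_renyiReal hρ hσ.1 h)).eventually_lt hout (hcon x)
  obtain ⟨α, hα, h0, h1⟩ := (hev.and (Ioo_mem_nhdsLT zero_lt_one)).exists
  have hne {C : Type} [Fintype C] {τ : Matrix C C ℂ} (hτ : IsDensity τ) : τ.trace ≠ 0 := by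
    rw [hτ.2]
    exact one_ne_zero
  obtain ⟨-, x, hx⟩ := exists_renyiReal_le_add_of_lt_one hν' hμ' hρ.1 hσ.1 h0.le h1
    (fun x => (petzQ_pos (hν' x) (hμ' x) (hs x) (hne (hν x)) α).ne')
    (petzQ_pos hρ.1 hσ.1 h (hne hρ) α).ne'
  exact (hα x).not_ge hx

lemma petzRenyi_idTensor_cqChannel_sub_le (hν : ∀ x, IsDensity (ν x))
    (hμ : ∀ x, IsDensity (μ x)) (hρ : IsDensity ρ) (hσ : IsDensity σ) {α : ℝ} (h0 : 0 ≤ α)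
    (h2 : α ≤ 2) :
    petzRenyi α (idTensor (cqChannel ν) ρ) (idTensor (cqChannel μ) σ) - petzRenyi α ρ σ ≤
      ⨆ x, petzRenyi α (ν x) (μ x) := by
  have hν' (x : X) := (hν x).1
  have hμ' (x : X) := (hμ x).1
  by_cases htop : ∃ x, petzRenyi α (ν x) (μ x) = ⊤
  · obtain ⟨x, hx⟩ := htop
    exact le_iSup_of_le x (hx ▸ le_top)
  by_cases hin : petzRenyi α ρ σ = ⊤
  · rw [hin, EReal.sub_top]
    exact bot_le
  push Not at htop
  suffices h : ∃ x, petzRenyi α (idTensor (cqChannel ν) ρ) (idTensor (cqChannel μ) σ) ≤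
      petzRenyi α (ν x) (μ x) + petzRenyi α ρ σ by
    obtain ⟨x, hx⟩ := h
    exact (EReal.sub_le_of_le_add hx).trans (le_iSup (fun x => petzRenyi α (ν x) (μ x)) x)
  rcases lt_trichotomy α 1 with h1 | rfl | h1
  · simp only [petzRenyi_of_lt_one (hν' _) (hμ' _) h1, petzRenyi_of_lt_one hρ.1 hσ.1 h1, ne_eq,
      ite_eq_left_iff, EReal.coe_ne_top, imp_false, not_not] at htop hin
    obtain ⟨hQ, x, hx⟩ := exists_renyiReal_le_add_of_lt_one hν' hμ' hρ.1 hσ.1 h0 h1 htop hin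
    refine ⟨x, ?_⟩
    rw [petzRenyi_of_lt_one (isDensity_idTensor_cqChannel hν hρ).1
      (isDensity_idTensor_cqChannel hμ hσ).1 h1, petzRenyi_of_lt_one (hν' x) (hμ' x) h1,
      petzRenyi_of_lt_one hρ.1 hσ.1 h1, if_neg hQ, if_neg (htop x), if_neg hin, ← EReal.coe_add]
    exact EReal.coe_le_coe_iff.2 hx
  · simp only [petzRenyi_one] at htop hin ⊢
    simp only [relEnt, ne_eq, ite_eq_right_iff, EReal.coe_ne_top, imp_false, not_not] at htop hin
    exact exists_relEnt_le_add hν hμ hρ hσ htop hin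
  · simp only [petzRenyi_of_one_lt h1] at htop hin ⊢
    simp only [ne_eq, ite_eq_right_iff, EReal.coe_ne_top, imp_false, not_not] at htop hin
    obtain ⟨x, hx⟩ := exists_renyiReal_le_add_of_one_lt hν hμ hρ hσ htop hin h1 h2
    refine ⟨x, ?_⟩
    rw [if_pos (suppLE_idTensor_cqChannel hν' hμ' hρ.1 hσ.1 htop hin), if_pos (htop x),
      if_pos hin, ← EReal.coe_add]
    exact EReal.coe_le_coe_iff.2 hx

lemma isDensity_single {n : Type} [Fintype n] [DecidableEq n] (i : n) :
    IsDensity (Matrix.single i i (1 : ℂ)) := by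
  refine ⟨?_, by simp⟩
  rw [← diagonal_single]
  exact PosSemidef.diagonal fun j => by
    by_cases h : j = i <;> simp [h]

lemma idTensor_cqChannel_single {X B : Type} [Fintype X] [DecidableEq X] [Fintype B]
    (ν : X → Matrix B B ℂ) (x : X) :
    idTensor (cqChannel ν) (Matrix.single ((0 : Fin 1), x) (0, x) 1) =
      (ν x).submatrix (Equiv.uniqueProd B (Fin 1)) (Equiv.uniqueProd B (Fin 1)) := by
  ext ⟨i, b⟩ ⟨j, c⟩
  obtain rfl := Subsingleton.elim i 0
  obtain rfl := Subsingleton.elim j 0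
  change (∑ y, Matrix.single ((0 : Fin 1), x) (0, x) (1 : ℂ) (0, y) (0, y) • ν y) b c = ν x b c
  rw [Fintype.sum_eq_single x fun y hy => by simp [hy.symm], Matrix.single_apply_same, one_smul]

end Channel

/-- Amortization collapse of the Petz–Rényi divergences for
classical-quantum channels: for `α ∈ [0,2]`, `D_α^𝒜(N‖M) = max_x D_α(ν^x‖μ^x)`. -/
theorem cq_petzRenyi_amortization_collapse
    {X B : Type} [Fintype X] [DecidableEq X] [Nonempty X] [Fintype B] [DecidableEq B]
    (ν μ : X → Matrix B B ℂ) (hν : ∀ x, IsDensity (ν x)) (hμ : ∀ x, IsDensity (μ x))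
    (α : ℝ) (hα0 : 0 ≤ α) (hα2 : α ≤ 2) :
    amortizedDiv (petzFam α) (cqChannel ν) (cqChannel μ) = ⨆ x, petzRenyi α (ν x) (μ x) := by
  apply le_antisymm
  · refine iSup_le fun R => iSup_le fun ρ => iSup_le fun σ => iSup_le fun hρ => iSup_le fun hσ => ?_
    exact petzRenyi_idTensor_cqChannel_sub_le hν hμ hρ hσ hα0 hα2
  · refine iSup_le fun x => ?_
    have hx := isDensity_single ((0 : Fin 1), x)
    refine le_iSup_of_le 1 (le_iSup_of_le _ (le_iSup_of_le _ (le_iSup_of_le hx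
      (le_iSup_of_le hx ?_))))
    simp only [petzFam]
    rw [petzRenyi_self hx, sub_zero, idTensor_cqChannel_single, idTensor_cqChannel_single,
      petzRenyi_submatrix (hν x).1.1 (hμ x).1.1]

end
end

section
/- Amortization collapse of the sandwiched Rényi divergence for replacer channels: let N : A → B be a quantum channel and let R : A → B be the replacer channel R(X) = Tr[X]·τ_B for a fixed density matrix τ_B on B. Then for every α > 1, D̃_α^A(N‖R) = D̃_α(N‖R), where D̃_α(N‖R) is the sandwiched Rényi channel divergence and D̃_α^A its amortized version. -/
open scoped BigOperators ComplexOrder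

noncomputable section

attribute [local instance] Classical.propDecidable

set_option linter.unusedSectionVars false

open scoped Kronecker
open Matrix

/-- Complex-valued spectral functional calculus of a Hermitian matrix. -/
def specFun {n : Type} [Fintype n] [DecidableEq n] (f : ℝ → ℂ) (A : Matrix n n ℂ) :
    Matrix n n ℂ :=
  if hA : A.IsHermitian then
    (hA.eigenvectorUnitary : Matrix n n ℂ) *
      Matrix.diagonal (fun i => f (hA.eigenvalues i)) *
      star (hA.eigenvectorUnitary : Matrix n n ℂ)
  else 0

theorem hermFun_eq_specFun {n : Type} [Fintype n] [DecidableEq n] (f : ℝ → ℝ)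
    (A : Matrix n n ℂ) : hermFun f A = specFun (fun x => (f x : ℂ)) A := rfl

/-- `A` is unitarily diagonalized by `U` with real eigenvalues `d`. -/
structure IsDiagonalization_s17 {n : Type} [Fintype n] [DecidableEq n] (A U : Matrix n n ℂ)
    (d : n → ℝ) : Prop where
  mul_conj : U * Uᴴ = 1
  conj_mul : Uᴴ * U = 1
  eq : A = U * Matrix.diagonal (fun i => (d i : ℂ)) * Uᴴ

section Spectral

variable {n : Type} [Fintype n] [DecidableEq n]

theorem isDiagonalization_eigen {A : Matrix n n ℂ} (hA : A.IsHermitian) :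
    IsDiagonalization_s17 A (hA.eigenvectorUnitary : Matrix n n ℂ) hA.eigenvalues where
  mul_conj := by
    have := Unitary.coe_mul_star_self hA.eigenvectorUnitary
    simpa [Matrix.star_eq_conjTranspose] using this
  conj_mul := by
    have := Unitary.coe_star_mul_self hA.eigenvectorUnitary
    simpa [Matrix.star_eq_conjTranspose] using this
  eq := by
    conv_lhs => rw [hA.spectral_theorem, Unitary.conjStarAlgAut_apply]
    rfl

theorem IsDiagonalization_s17.isHermitian {A U : Matrix n n ℂ} {d : n → ℝ}
    (h : IsDiagonalization_s17 A U d) : A.IsHermitian := by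
  rw [h.eq, Matrix.IsHermitian]
  simp only [conjTranspose_mul, conjTranspose_conjTranspose, diagonal_conjTranspose, mul_assoc]
  congr 3
  ext i
  simp

/-- The functional calculus does not depend on the diagonalization. -/
theorem IsDiagonalization_s17.specFun_eq {A U : Matrix n n ℂ} {d : n → ℝ}
    (h : IsDiagonalization_s17 A U d) (f : ℝ → ℂ) :
    specFun f A = U * Matrix.diagonal (fun i => f (d i)) * Uᴴ := by
  have hA := h.isHermitian
  have k := isDiagonalization_eigen hA
  rw [specFun, dif_pos hA, Matrix.star_eq_conjTranspose]
  set V : Matrix n n ℂ := (hA.eigenvectorUnitary : Matrix n n ℂ)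
  set e := hA.eigenvalues
  have h1 : Matrix.diagonal (fun i => (e i : ℂ)) * (Vᴴ * U) =
      (Vᴴ * U) * Matrix.diagonal (fun i => (d i : ℂ)) := by
    have h2 : Vᴴ * A * U = Vᴴ * A * U := rfl
    conv_lhs at h2 => rw [k.eq]
    conv_rhs at h2 => rw [h.eq]
    have e1 : Vᴴ * (V * Matrix.diagonal (fun i => (e i : ℂ)) * Vᴴ) * U =
        (Vᴴ * V) * (Matrix.diagonal (fun i => (e i : ℂ)) * (Vᴴ * U)) := by noncomm_ring
    have e2 : Vᴴ * (U * Matrix.diagonal (fun i => (d i : ℂ)) * Uᴴ) * U =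
        (Vᴴ * U) * Matrix.diagonal (fun i => (d i : ℂ)) * (Uᴴ * U) := by noncomm_ring
    rw [e1, e2, k.conj_mul, h.conj_mul, one_mul, mul_one] at h2
    exact h2
  have h3 : Matrix.diagonal (fun i => f (e i)) * (Vᴴ * U) =
      (Vᴴ * U) * Matrix.diagonal (fun i => f (d i)) := by
    ext i j
    have h4 := congrFun (congrFun h1 i) j
    rw [diagonal_mul, mul_diagonal] at h4 ⊢
    by_cases hW : (Vᴴ * U) i j = 0
    · simp [hW]
    · rw [mul_comm] at h4
      have h5 := mul_left_cancel₀ hW h4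
      have h6 : e i = d j := by exact_mod_cast h5
      rw [h6, mul_comm]
  calc V * Matrix.diagonal (fun i => f (e i)) * Vᴴ
      = V * Matrix.diagonal (fun i => f (e i)) * Vᴴ * (U * Uᴴ) := by rw [h.mul_conj, mul_one]
    _ = V * (Matrix.diagonal (fun i => f (e i)) * (Vᴴ * U)) * Uᴴ := by noncomm_ring
    _ = (V * Vᴴ) * U * Matrix.diagonal (fun i => f (d i)) * Uᴴ := by rw [h3]; noncomm_ring
    _ = _ := by rw [k.mul_conj, one_mul]

theorem specFun_mul {A : Matrix n n ℂ} (hA : A.IsHermitian) (f g : ℝ → ℂ) :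
    specFun f A * specFun g A = specFun (fun x => f x * g x) A := by
  have k := isDiagonalization_eigen hA
  rw [k.specFun_eq, k.specFun_eq, k.specFun_eq]
  set V : Matrix n n ℂ := (hA.eigenvectorUnitary : Matrix n n ℂ)
  calc _ = V * Matrix.diagonal (fun i => f (hA.eigenvalues i)) * (Vᴴ * V) *
        Matrix.diagonal (fun i => g (hA.eigenvalues i)) * Vᴴ := by noncomm_ring
    _ = _ := by
      rw [k.conj_mul, mul_one, mul_assoc V, diagonal_mul_diagonal]

theorem specFun_congr {A : Matrix n n ℂ} (hA : A.PosSemidef) {f g : ℝ → ℂ}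
    (h : ∀ x, 0 ≤ x → f x = g x) : specFun f A = specFun g A := by
  have k := isDiagonalization_eigen hA.1
  rw [k.specFun_eq, k.specFun_eq]
  congr 3
  ext i
  exact h _ (hA.eigenvalues_nonneg i)

theorem specFun_conjTranspose {A : Matrix n n ℂ} (hA : A.IsHermitian) (f : ℝ → ℂ) :
    (specFun f A)ᴴ = specFun (fun x => star (f x)) A := by
  have k := isDiagonalization_eigen hA
  rw [k.specFun_eq, k.specFun_eq]
  simp only [conjTranspose_mul, conjTranspose_conjTranspose, diagonal_conjTranspose, mul_assoc]
  rfl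

theorem specFun_ofReal {A : Matrix n n ℂ} (hA : A.IsHermitian) :
    specFun (fun x => (x : ℂ)) A = A := by
  have k := isDiagonalization_eigen hA
  rw [k.specFun_eq, ← k.eq]

/-- The power function with complex exponent and the convention `0 ↦ 0`. -/
def suppCpow (z : ℂ) (x : ℝ) : ℂ := if x = 0 then 0 else (x : ℂ) ^ z

theorem suppCpow_mul (z w : ℂ) (x : ℝ) : suppCpow z x * suppCpow w x = suppCpow (z + w) x := by
  by_cases hx : x = 0
  · simp [suppCpow, hx]
  · simp [suppCpow, hx, Complex.cpow_add _ _ (Complex.ofReal_ne_zero.2 hx)]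

theorem suppCpow_star (z : ℂ) {x : ℝ} (hx : 0 ≤ x) :
    star (suppCpow z x) = suppCpow (star z) x := by
  by_cases hx0 : x = 0
  · simp [suppCpow, hx0]
  · simp only [suppCpow, hx0, if_false]
    have := Complex.conj_cpow (x : ℂ) (star z) (by
      rw [Complex.arg_ofReal_of_nonneg hx]; exact Real.pi_pos.ne)
    simp only [Complex.conj_ofReal] at this
    rw [this]; simp

theorem suppCpow_ofReal (r : ℝ) {x : ℝ} (hx : 0 ≤ x) :
    suppCpow r x = (if x = 0 then (0 : ℝ) else Real.rpow x r : ℝ) := by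
  by_cases hx0 : x = 0
  · simp [suppCpow, hx0]
  · simp only [suppCpow, hx0, if_false]
    exact (Complex.ofReal_cpow hx r).symm

/-- Complex powers of a positive semidefinite matrix, vanishing on its kernel. -/
def cPow (A : Matrix n n ℂ) (z : ℂ) : Matrix n n ℂ := specFun (suppCpow z) A

theorem matPow_eq_cPow {A : Matrix n n ℂ} (hA : A.PosSemidef) (r : ℝ) :
    matPow A r = cPow A r := by
  rw [matPow, hermFun_eq_specFun, cPow]
  exact specFun_congr hA fun x hx => (suppCpow_ofReal r hx).symm

theorem cPow_mul {A : Matrix n n ℂ} (hA : A.PosSemidef) (z w : ℂ) :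
    cPow A z * cPow A w = cPow A (z + w) := by
  rw [cPow, cPow, specFun_mul hA.1, cPow]
  congr 1
  ext x
  exact suppCpow_mul z w x

theorem cPow_conjTranspose {A : Matrix n n ℂ} (hA : A.PosSemidef) (z : ℂ) :
    (cPow A z)ᴴ = cPow A (star z) := by
  rw [cPow, specFun_conjTranspose hA.1, cPow]
  exact specFun_congr hA fun x hx => suppCpow_star z hx

theorem cPow_one {A : Matrix n n ℂ} (hA : A.PosSemidef) : cPow A 1 = A := by
  conv_rhs => rw [← specFun_ofReal hA.1]
  rw [cPow]
  congr 1
  ext x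
  by_cases hx : x = 0 <;> simp [suppCpow, hx]

theorem cPow_ofReal_posSemidef {A : Matrix n n ℂ} (hA : A.PosSemidef) (r : ℝ) :
    (cPow A r).PosSemidef := by
  have h : cPow A r = (cPow A ((r / 2 : ℝ) : ℂ))ᴴ * cPow A ((r / 2 : ℝ) : ℂ) := by
    rw [cPow_conjTranspose hA, cPow_mul hA]
    congr 1
    simp
  rw [h]
  exact posSemidef_conjTranspose_mul_self _

theorem IsDiagonalization_s17.nonneg {A U : Matrix n n ℂ} {d : n → ℝ}
    (h : IsDiagonalization_s17 A U d) (hA : A.PosSemidef) (i : n) : 0 ≤ d i := by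
  have h1 := hA.conjTranspose_mul_mul_same U
  have h2 : Uᴴ * A * U = Matrix.diagonal (fun i => (d i : ℂ)) := by
    rw [h.eq]
    calc _ = (Uᴴ * U) * Matrix.diagonal (fun i => (d i : ℂ)) * (Uᴴ * U) := by noncomm_ring
      _ = _ := by rw [h.conj_mul, one_mul, mul_one]
  rw [h2, posSemidef_diagonal_iff] at h1
  exact_mod_cast h1 i

/-- Powers of a scaled power. -/
theorem cPow_smul_cPow {A : Matrix n n ℂ} (hA : A.PosSemidef) {c : ℝ} (hc : 0 < c) (r s : ℝ) :
    cPow (c • cPow A r) s = (c ^ s) • cPow A ((r * s : ℝ) : ℂ) := by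
  have k := isDiagonalization_eigen hA.1
  set V : Matrix n n ℂ := (hA.1.eigenvectorUnitary : Matrix n n ℂ)
  set d := hA.1.eigenvalues
  have hd : ∀ i, 0 ≤ d i := k.nonneg hA
  have k' : IsDiagonalization_s17 (c • cPow A r) V
      (fun i => c * (if d i = 0 then (0 : ℝ) else Real.rpow (d i) r)) := by
    refine ⟨k.mul_conj, k.conj_mul, ?_⟩
    rw [cPow, k.specFun_eq, ← smul_mul_assoc, ← mul_smul_comm, ← diagonal_smul]
    congr 3
    ext i
    by_cases h0 : d i = 0
    · simp [suppCpow, h0]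
    · simp [suppCpow_ofReal r (hd i), h0]
  rw [cPow, k'.specFun_eq, cPow, k.specFun_eq, ← smul_mul_assoc, ← mul_smul_comm, ← diagonal_smul]
  congr 3
  ext i
  rw [Pi.smul_apply]
  by_cases h0 : d i = 0
  · simp [suppCpow, h0]
  · have hp : 0 < d i := lt_of_le_of_ne (hd i) (Ne.symm h0)
    have hq : 0 < Real.rpow (d i) r := Real.rpow_pos_of_pos hp r
    simp only [h0, if_false]
    rw [suppCpow_ofReal _ (mul_pos hc hq).le, suppCpow_ofReal _ hp.le]
    rw [if_neg (mul_pos hc hq).ne', if_neg h0]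
    simp only [Real.rpow_eq_pow]
    rw [Real.mul_rpow hc.le (Real.rpow_nonneg hp.le r), ← Real.rpow_mul hp.le]
    simp

theorem cPow_cPow {A : Matrix n n ℂ} (hA : A.PosSemidef) (r s : ℝ) :
    cPow (cPow A r) s = cPow A ((r * s : ℝ) : ℂ) := by
  have := cPow_smul_cPow hA one_pos r s
  simpa using this

theorem cPow_smul {A : Matrix n n ℂ} (hA : A.PosSemidef) {c : ℝ} (hc : 0 < c) (s : ℝ) :
    cPow (c • A) s = (c ^ s) • cPow A s := by
  have := cPow_smul_cPow hA hc 1 s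
  simpa [cPow_one hA] using this

theorem diagonal_kronecker_diagonal' {m : Type} [DecidableEq m] [DecidableEq (n × m)]
    (a : n → ℂ) (b : m → ℂ) :
    Matrix.diagonal a ⊗ₖ Matrix.diagonal b = Matrix.diagonal (fun p => a p.1 * b p.2) := by
  rw [diagonal_kronecker_diagonal]
  congr 1
  exact Subsingleton.elim _ _

theorem cPow_kronecker {m : Type} [Fintype m] [DecidableEq m] {A : Matrix n n ℂ}
    {B : Matrix m m ℂ} (hA : A.PosSemidef) (hB : B.PosSemidef) (r : ℝ) :
    cPow (A ⊗ₖ B) r = cPow A r ⊗ₖ cPow B r := by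
  have k := isDiagonalization_eigen hA.1
  have l := isDiagonalization_eigen hB.1
  set V : Matrix n n ℂ := (hA.1.eigenvectorUnitary : Matrix n n ℂ)
  set W : Matrix m m ℂ := (hB.1.eigenvectorUnitary : Matrix m m ℂ)
  set d := hA.1.eigenvalues
  set e := hB.1.eigenvalues
  have hd : ∀ i, 0 ≤ d i := k.nonneg hA
  have he : ∀ i, 0 ≤ e i := l.nonneg hB
  have kl : IsDiagonalization_s17 (A ⊗ₖ B) (V ⊗ₖ W) (fun p => d p.1 * e p.2) := by
    refine ⟨?_, ?_, ?_⟩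
    · rw [conjTranspose_kronecker, ← mul_kronecker_mul, k.mul_conj, l.mul_conj]
      convert one_kronecker_one (α := ℂ) (m := n) (n := m)
    · rw [conjTranspose_kronecker, ← mul_kronecker_mul, k.conj_mul, l.conj_mul]
      convert one_kronecker_one (α := ℂ) (m := n) (n := m)
    · conv_lhs => rw [k.eq, l.eq]
      rw [mul_kronecker_mul, mul_kronecker_mul, ← conjTranspose_kronecker]
      congr 2
      rw [diagonal_kronecker_diagonal']
      congr 1
      ext p
      simp
  rw [cPow, kl.specFun_eq, cPow, cPow, k.specFun_eq, l.specFun_eq, mul_kronecker_mul,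
    mul_kronecker_mul, ← conjTranspose_kronecker]
  congr 2
  rw [diagonal_kronecker_diagonal']
  congr 1
  ext p
  rw [suppCpow_ofReal _ (mul_nonneg (hd _) (he _)), suppCpow_ofReal _ (hd _),
    suppCpow_ofReal _ (he _)]
  by_cases h1 : d p.1 = 0
  · simp [h1]
  by_cases h2 : e p.2 = 0
  · simp [h2]
  rw [if_neg (mul_ne_zero h1 h2), if_neg h1, if_neg h2]
  simp only [Real.rpow_eq_pow]
  rw [Real.mul_rpow (hd _) (he _)]
  simp

end Spectral
section TraceInequalities

variable {n : Type} [Fintype n] [DecidableEq n]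

theorem norm_trace_mul_le (A B : Matrix n n ℂ) :
    ‖(A * B).trace‖ ≤ ((A * Aᴴ).trace.re + (Bᴴ * B).trace.re) / 2 := by
  have h1 : (A * Aᴴ).trace.re = ∑ i, ∑ j, ‖A i j‖ ^ 2 := by
    simp only [trace, diag_apply, mul_apply, conjTranspose_apply, Complex.re_sum]
    refine Finset.sum_congr rfl fun i _ => Finset.sum_congr rfl fun j _ => ?_
    rw [Complex.star_def, Complex.mul_conj, Complex.normSq_eq_norm_sq, Complex.ofReal_re]
  have h2 : (Bᴴ * B).trace.re = ∑ i, ∑ j, ‖B j i‖ ^ 2 := by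
    simp only [trace, diag_apply, mul_apply, conjTranspose_apply, Complex.re_sum]
    refine Finset.sum_congr rfl fun i _ => Finset.sum_congr rfl fun j _ => ?_
    rw [Complex.star_def, mul_comm, Complex.mul_conj, Complex.normSq_eq_norm_sq,
      Complex.ofReal_re]
  rw [h1, h2, ← Finset.sum_add_distrib, Finset.sum_div]
  simp only [trace, diag_apply, mul_apply]
  refine (norm_sum_le _ _).trans (Finset.sum_le_sum fun i _ => ?_)
  rw [← Finset.sum_add_distrib, Finset.sum_div]
  refine (norm_sum_le _ _).trans (Finset.sum_le_sum fun j _ => ?_)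
  rw [norm_mul]
  nlinarith [sq_nonneg (‖A i j‖ - ‖B j i‖)]

/-- `K` is a contraction: `Kᴴ K ≤ 1`. -/
def IsContraction (K : Matrix n n ℂ) : Prop := (1 - Kᴴ * K).PosSemidef

theorem IsContraction.mul {K L : Matrix n n ℂ} (hK : IsContraction K) (hL : IsContraction L) :
    IsContraction (K * L) := by
  have h : 1 - (K * L)ᴴ * (K * L) = (1 - Lᴴ * L) + Lᴴ * (1 - Kᴴ * K) * L := by
    rw [conjTranspose_mul]; noncomm_ring
  rw [IsContraction, h]
  exact hL.add (hK.conjTranspose_mul_mul_same L)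

theorem trace_mul_contraction_le {K B : Matrix n n ℂ} (hK : IsContraction K) :
    ((K * B)ᴴ * (K * B)).trace.re ≤ (Bᴴ * B).trace.re := by
  have h : (K * B)ᴴ * (K * B) = Bᴴ * B - Bᴴ * (1 - Kᴴ * K) * B := by
    rw [conjTranspose_mul]; noncomm_ring
  have h2 := (hK.conjTranspose_mul_mul_same B).trace_nonneg
  rw [h, trace_sub, Complex.sub_re]
  have := (Complex.le_def.1 h2).1
  simp only [Complex.zero_re] at this
  linarith

theorem norm_trace_mul_contraction_mul_le {A K B : Matrix n n ℂ} {c : ℝ} (hK : IsContraction K)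
    (hA : (A * Aᴴ).trace.re ≤ c) (hB : (Bᴴ * B).trace.re ≤ c) :
    ‖(A * K * B).trace‖ ≤ c := by
  rw [mul_assoc]
  refine (norm_trace_mul_le A (K * B)).trans ?_
  have := trace_mul_contraction_le (B := B) hK
  linarith

theorem one_sub_cPow_zero_posSemidef {A : Matrix n n ℂ} (hA : A.PosSemidef) :
    (1 - cPow A 0).PosSemidef := by
  have h : 1 - cPow A 0 = (1 - cPow A 0)ᴴ * (1 - cPow A 0) := by
    rw [conjTranspose_sub, conjTranspose_one, cPow_conjTranspose hA, star_zero, sub_mul, mul_sub,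
      mul_sub, cPow_mul hA, add_zero]
    simp
  rw [h]
  exact posSemidef_conjTranspose_mul_self _

theorem isContraction_cPow {A : Matrix n n ℂ} (hA : A.PosSemidef) {z : ℂ} (hz : z.re = 0) :
    IsContraction (cPow A z) := by
  have h : star z + z = 0 := by
    apply Complex.ext <;> simp [hz]
  rw [IsContraction, cPow_conjTranspose hA, cPow_mul hA, h]
  exact one_sub_cPow_zero_posSemidef hA

theorem trace_conj_cPow_zero_le {A B : Matrix n n ℂ} (hA : A.PosSemidef) :
    (Bᴴ * cPow A 0 * B).trace.re ≤ (Bᴴ * B).trace.re := by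
  have h2 := ((one_sub_cPow_zero_posSemidef hA).conjTranspose_mul_mul_same B).trace_nonneg
  have := (Complex.le_def.1 h2).1
  rw [mul_sub, sub_mul, mul_one, trace_sub, Complex.sub_re, Complex.zero_re] at this
  linarith

end TraceInequalities

section PartialTrace

variable {R n : Type} [Fintype R] [DecidableEq R] [Fintype n] [DecidableEq n]

/-- Partial trace over the right factor. -/
def ptraceRight (S : Matrix (R × n) (R × n) ℂ) : Matrix R R ℂ :=
  fun r s => ∑ a, S (r, a) (s, a)

/-- Extension of an operator on the left factor by the identity. -/
def leftExt (M : Matrix R R ℂ) : Matrix (R × n) (R × n) ℂ :=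
  fun p q => if p.2 = q.2 then M p.1 q.1 else 0

theorem leftExt_mul_apply (M : Matrix R R ℂ) (S : Matrix (R × n) (R × n) ℂ) (p q : R × n) :
    ((leftExt M : Matrix (R × n) (R × n) ℂ) * S) p q = ∑ r, M p.1 r * S (r, p.2) q := by
  rw [mul_apply, Fintype.sum_prod_type]
  refine Finset.sum_congr rfl fun r _ => ?_
  simp [leftExt]

theorem mul_leftExt_apply (M : Matrix R R ℂ) (S : Matrix (R × n) (R × n) ℂ) (p q : R × n) :
    (S * (leftExt M : Matrix (R × n) (R × n) ℂ)) p q = ∑ r, S p (r, q.2) * M r q.1 := by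
  rw [mul_apply, Fintype.sum_prod_type]
  refine Finset.sum_congr rfl fun r _ => ?_
  simp [leftExt]

theorem leftExt_mul (M L : Matrix R R ℂ) :
    (leftExt (M * L) : Matrix (R × n) (R × n) ℂ) = leftExt M * leftExt L := by
  ext p q
  rw [leftExt_mul_apply]
  by_cases h : p.2 = q.2 <;> simp [leftExt, h, mul_apply]

theorem leftExt_one : (leftExt 1 : Matrix (R × n) (R × n) ℂ) = 1 := by
  ext p q
  rcases p with ⟨r, a⟩
  rcases q with ⟨s, b⟩
  by_cases h : a = b <;> simp [leftExt, h, one_apply]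

theorem leftExt_sub (M L : Matrix R R ℂ) :
    (leftExt (M - L) : Matrix (R × n) (R × n) ℂ) = leftExt M - leftExt L := by
  ext p q
  by_cases h : p.2 = q.2 <;> simp [leftExt, h]

theorem leftExt_smul (c : ℝ) (M : Matrix R R ℂ) :
    (leftExt (c • M) : Matrix (R × n) (R × n) ℂ) = c • leftExt M := by
  ext p q
  by_cases h : p.2 = q.2 <;> simp [leftExt, h]

theorem leftExt_conjTranspose (M : Matrix R R ℂ) :
    (leftExt M : Matrix (R × n) (R × n) ℂ)ᴴ = leftExt Mᴴ := by
  ext p q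
  by_cases h : p.2 = q.2
  · simp [leftExt, h]
  · simp [leftExt, h, Ne.symm h]

theorem ptraceRight_leftExt_mul (M : Matrix R R ℂ) (S : Matrix (R × n) (R × n) ℂ) :
    ptraceRight (leftExt M * S) = M * ptraceRight S := by
  ext r s
  simp only [ptraceRight, leftExt_mul_apply]
  simp only [mul_apply, ptraceRight, Finset.mul_sum]
  exact Finset.sum_comm

theorem ptraceRight_mul_leftExt (M : Matrix R R ℂ) (S : Matrix (R × n) (R × n) ℂ) :
    ptraceRight (S * leftExt M) = ptraceRight S * M := by
  ext r s
  simp only [ptraceRight, mul_leftExt_apply]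
  simp only [mul_apply, ptraceRight, Finset.sum_mul]
  exact Finset.sum_comm

theorem trace_ptraceRight (S : Matrix (R × n) (R × n) ℂ) :
    (ptraceRight S).trace = S.trace := by
  simp [trace, ptraceRight, Fintype.sum_prod_type]

theorem trace_leftExt_mul (M : Matrix R R ℂ) (S : Matrix (R × n) (R × n) ℂ) :
    (leftExt M * S).trace = (M * ptraceRight S).trace := by
  rw [← trace_ptraceRight, ptraceRight_leftExt_mul]

theorem ptraceRight_smul (c : ℝ) (S : Matrix (R × n) (R × n) ℂ) :
    ptraceRight (c • S) = c • ptraceRight S := by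
  ext r s
  simp [ptraceRight, Finset.mul_sum]

theorem ptraceRight_posSemidef {S : Matrix (R × n) (R × n) ℂ} (hS : S.PosSemidef) :
    (ptraceRight S).PosSemidef := by
  have h : ptraceRight S = ∑ a : n, S.submatrix (fun r => (r, a)) (fun r => (r, a)) := by
    ext r s
    simp [ptraceRight, Matrix.sum_apply]
  rw [h]
  exact Finset.sum_induction _ _ (fun _ _ => PosSemidef.add) PosSemidef.zero
    fun a _ => hS.submatrix _

theorem leftExt_posSemidef {M : Matrix R R ℂ} (hM : M.PosSemidef) :
    (leftExt M : Matrix (R × n) (R × n) ℂ).PosSemidef := by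
  have h : (leftExt M : Matrix (R × n) (R × n) ℂ) = M ⊗ₖ (1 : Matrix n n ℂ) := by
    ext p q
    simp [leftExt, kroneckerMap_apply, one_apply]
  rw [h]
  exact hM.kronecker PosSemidef.one

theorem isContraction_leftExt {K : Matrix R R ℂ} (hK : IsContraction K) :
    IsContraction (leftExt K : Matrix (R × n) (R × n) ℂ) := by
  have h := leftExt_posSemidef (n := n) hK
  rwa [leftExt_sub, leftExt_one, leftExt_mul, ← leftExt_conjTranspose] at h

/-- A positive semidefinite operator annihilated on both sides is annihilated on one side. -/
theorem mul_eq_zero_of_conj_eq_zero {m : Type} [Fintype m] [DecidableEq m]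
    {S C : Matrix m m ℂ} (hS : S.PosSemidef) (h : (Cᴴ * S * C).trace = 0) : S * C = 0 := by
  have hS' : S = cPow S ((1 / 2 : ℝ) : ℂ) * cPow S ((1 / 2 : ℝ) : ℂ) := by
    rw [cPow_mul hS, ← Complex.ofReal_add]
    norm_num
    exact (cPow_one hS).symm
  have hH : (cPow S ((1 / 2 : ℝ) : ℂ))ᴴ = cPow S ((1 / 2 : ℝ) : ℂ) :=
    (cPow_ofReal_posSemidef hS _).1
  set Q := cPow S ((1 / 2 : ℝ) : ℂ)
  have h1 : Cᴴ * S * C = (Q * C)ᴴ * (Q * C) := by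
    rw [conjTranspose_mul, hH, hS']; noncomm_ring
  rw [h1, trace_conjTranspose_mul_self_eq_zero_iff] at h
  rw [hS', mul_assoc, h, mul_zero]

/-- The support of a bipartite operator lies in the support of its marginal. -/
theorem mul_leftExt_supp {S : Matrix (R × n) (R × n) ℂ} (hS : S.PosSemidef) :
    S * leftExt (cPow (ptraceRight S) 0) = S := by
  have hT := ptraceRight_posSemidef hS
  set T := ptraceRight S
  have h1 : T * (1 - cPow T 0) = 0 := by
    rw [mul_sub, mul_one]
    nth_rw 2 [← cPow_one hT]
    rw [cPow_mul hT, add_zero, cPow_one hT, sub_self]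
  have h2 : S * leftExt (1 - cPow T 0) = 0 := by
    refine mul_eq_zero_of_conj_eq_zero hS ?_
    rw [leftExt_conjTranspose, mul_assoc, trace_leftExt_mul, ptraceRight_mul_leftExt, h1, mul_zero,
      trace_zero]
  rw [leftExt_sub, leftExt_one, mul_sub, mul_one, sub_eq_zero] at h2
  exact h2.symm

theorem leftExt_supp_mul {S : Matrix (R × n) (R × n) ℂ} (hS : S.PosSemidef) :
    leftExt (cPow (ptraceRight S) 0) * S = S := by
  have h := congrArg conjTranspose (mul_leftExt_supp hS)
  rw [conjTranspose_mul, leftExt_conjTranspose, cPow_conjTranspose (ptraceRight_posSemidef hS),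
    star_zero, hS.1] at h
  exact h

end PartialTrace
section Interpolation

open Complex.HadamardThreeLines

/-- Entire functions that are bounded on the strip `0 ≤ re z ≤ 1`. -/
def IsStripBounded (f : ℂ → ℂ) : Prop :=
  Differentiable ℂ f ∧ ∃ C : ℝ, ∀ z : ℂ, 0 ≤ z.re → z.re ≤ 1 → ‖f z‖ ≤ C

theorem IsStripBounded.const (c : ℂ) : IsStripBounded (fun _ => c) :=
  ⟨differentiable_const c, ‖c‖, fun _ _ _ => le_rfl⟩

theorem IsStripBounded.add {f g : ℂ → ℂ} (hf : IsStripBounded f) (hg : IsStripBounded g) :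
    IsStripBounded (fun z => f z + g z) := by
  obtain ⟨C, hC⟩ := hf.2
  obtain ⟨D, hD⟩ := hg.2
  exact ⟨hf.1.add hg.1, C + D, fun z h0 h1 =>
    (norm_add_le _ _).trans (add_le_add (hC z h0 h1) (hD z h0 h1))⟩

theorem IsStripBounded.mul {f g : ℂ → ℂ} (hf : IsStripBounded f) (hg : IsStripBounded g) :
    IsStripBounded (fun z => f z * g z) := by
  obtain ⟨C, hC⟩ := hf.2
  obtain ⟨D, hD⟩ := hg.2
  refine ⟨hf.1.mul hg.1, C * D, fun z h0 h1 => ?_⟩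
  rw [norm_mul]
  exact mul_le_mul (hC z h0 h1) (hD z h0 h1) (norm_nonneg _)
    ((norm_nonneg _).trans (hC z h0 h1))

theorem IsStripBounded.sum {ι : Type} (s : Finset ι) {f : ι → ℂ → ℂ}
    (hf : ∀ i, IsStripBounded (f i)) : IsStripBounded (fun z => ∑ i ∈ s, f i z) := by
  classical
  induction s using Finset.induction_on with
  | empty => simpa using IsStripBounded.const 0
  | insert a s ha ih =>
    simp only [Finset.sum_insert ha]
    exact (hf a).add ih

theorem IsStripBounded.suppCpow {x : ℝ} (hx : 0 ≤ x) (a b : ℝ) :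
    IsStripBounded (fun z => suppCpow (a * z + b) x) := by
  by_cases h0 : x = 0
  · simpa [_root_.suppCpow, h0] using IsStripBounded.const 0
  have hp : 0 < x := lt_of_le_of_ne hx (Ne.symm h0)
  simp only [_root_.suppCpow, h0, if_false]
  refine ⟨?_, ?_⟩
  · have h : ((x : ℂ) ≠ 0) := Complex.ofReal_ne_zero.2 h0
    intro z
    exact ((differentiableAt_id.const_mul (a : ℂ)).add_const (b : ℂ)).const_cpow (Or.inl h)
  · have hc : ContinuousOn (fun t : ℝ => x ^ (a * t + b)) (Set.Icc 0 1) := by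
      refine Continuous.continuousOn ?_
      exact Continuous.rpow continuous_const (by fun_prop) fun _ => Or.inl h0
    obtain ⟨C, hC⟩ := isCompact_Icc.exists_bound_of_continuousOn hc
    refine ⟨C, fun z h1 h2 => ?_⟩
    have := hC z.re ⟨h1, h2⟩
    rw [Complex.norm_cpow_eq_rpow_re_of_pos hp]
    rw [Real.norm_of_nonneg (Real.rpow_nonneg hx _)] at this
    simpa using this

/-- Matrix families whose entries are entire and bounded on the strip. -/
def IsStripBoundedMatrix {n : Type} (F : ℂ → Matrix n n ℂ) : Prop :=
  ∀ i j, IsStripBounded (fun z => F z i j)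

theorem IsStripBoundedMatrix.const {n : Type} (A : Matrix n n ℂ) :
    IsStripBoundedMatrix (fun _ => A) := fun _ _ => IsStripBounded.const _

theorem IsStripBoundedMatrix.mul {n : Type} [Fintype n] {F G : ℂ → Matrix n n ℂ}
    (hF : IsStripBoundedMatrix F) (hG : IsStripBoundedMatrix G) :
    IsStripBoundedMatrix (fun z => F z * G z) := fun i j => by
  simp only [mul_apply]
  exact IsStripBounded.sum _ fun k => (hF i k).mul (hG k j)

theorem IsStripBoundedMatrix.trace {n : Type} [Fintype n] {F : ℂ → Matrix n n ℂ}
    (hF : IsStripBoundedMatrix F) : IsStripBounded (fun z => (F z).trace) := by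
  simp only [Matrix.trace, diag_apply]
  exact IsStripBounded.sum _ fun k => hF k k

theorem IsStripBoundedMatrix.leftExt {R n : Type} [DecidableEq n] {F : ℂ → Matrix R R ℂ}
    (hF : IsStripBoundedMatrix F) :
    IsStripBoundedMatrix (fun z => (leftExt (F z) : Matrix (R × n) (R × n) ℂ)) := fun p q => by
  by_cases h : p.2 = q.2
  · simpa [_root_.leftExt, h] using hF p.1 q.1
  · simpa [_root_.leftExt, h] using IsStripBounded.const 0

theorem IsStripBoundedMatrix.cPow {n : Type} [Fintype n] [DecidableEq n] {A : Matrix n n ℂ}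
    (hA : A.PosSemidef) (a b : ℝ) : IsStripBoundedMatrix (fun z => cPow A (a * z + b)) := by
  have k := isDiagonalization_eigen hA.1
  simp only [_root_.cPow, k.specFun_eq]
  refine ((IsStripBoundedMatrix.const _).mul fun i j => ?_).mul (IsStripBoundedMatrix.const _)
  by_cases h : i = j
  · subst h
    simpa using IsStripBounded.suppCpow (hA.eigenvalues_nonneg i) a b
  · simpa [h] using IsStripBounded.const 0

theorem IsStripBounded.norm_le_interp {f : ℂ → ℂ} (hf : IsStripBounded f) {a b θ : ℝ}
    (h0 : ∀ z : ℂ, z.re = 0 → ‖f z‖ ≤ a) (h1 : ∀ z : ℂ, z.re = 1 → ‖f z‖ ≤ b)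
    (hθ0 : 0 ≤ θ) (hθ1 : θ ≤ 1) : ‖f θ‖ ≤ a ^ (1 - θ) * b ^ θ := by
  obtain ⟨C, hC⟩ := hf.2
  have h := norm_le_interp_of_mem_verticalClosedStrip₀₁' f (z := (θ : ℂ)) (a := a) (b := b)
    (by simpa [verticalClosedStrip] using ⟨hθ0, hθ1⟩) hf.1.diffContOnCl
    ⟨C, by
      rintro _ ⟨z, hz, rfl⟩
      exact hC z hz.1 hz.2⟩
    (fun z hz => h0 z hz) (fun z hz => h1 z hz)
  simpa using h

end Interpolation

section DataProcessing

variable {R n : Type} [Fintype R] [DecidableEq R] [Fintype n] [DecidableEq n]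

theorem norm_trace_cPow_eq {m : Type} [Fintype m] [DecidableEq m] {A : Matrix m m ℂ}
    (hA : A.PosSemidef) (r : ℝ) : ‖(cPow A r).trace‖ = (cPow A r).trace.re := by
  have h := (cPow_ofReal_posSemidef hA r).trace_nonneg
  have h2 := congrArg Complex.re (Complex.norm_of_nonneg' h)
  simpa using h2

set_option maxHeartbeats 1000000 in
theorem trace_sandwich_ptraceRight_le {ρ σ : Matrix (R × n) (R × n) ℂ} (hρ : ρ.PosSemidef)
    (hσ : σ.PosSemidef) (hs : ρ * cPow σ 0 = ρ) (hs' : cPow σ 0 * ρ = ρ) {α k : ℝ} (hα : 1 < α)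
    (hk : k = (1 - α) / (2 * α)) {X : Matrix (R × n) (R × n) ℂ} {Z : Matrix R R ℂ}
    (hX : X = cPow σ k * ρ * cPow σ k)
    (hZ : Z = cPow (ptraceRight σ) k * ptraceRight ρ * cPow (ptraceRight σ) k) :
    (cPow Z α).trace.re ≤ (cPow X α).trace.re := by
  have hα0 : 0 < α := by linarith
  have hσR := ptraceRight_posSemidef hσ
  have hρR := ptraceRight_posSemidef hρ
  set τ := ptraceRight σ
  have hXp : X.PosSemidef := by
    have := hρ.mul_mul_conjTranspose_same (cPow σ k)
    rw [cPow_conjTranspose hσ] at this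
    simpa [hX] using this
  have hZp : Z.PosSemidef := by
    have := hρR.mul_mul_conjTranspose_same (cPow τ k)
    rw [cPow_conjTranspose hσR] at this
    simpa [hZ] using this
  set a := (cPow X α).trace.re
  set b := (cPow Z α).trace.re
  have ha : 0 ≤ a := (Complex.le_def.1 (cPow_ofReal_posSemidef hXp α).trace_nonneg).1
  have hb : 0 ≤ b := (Complex.le_def.1 (cPow_ofReal_posSemidef hZp α).trace_nonneg).1
  let L : ℂ → Matrix (R × n) (R × n) ℂ := fun z =>
    leftExt (cPow τ ((-(1 / 2) : ℝ) * z + (0 : ℝ)) * cPow Z ((α : ℝ) * z + (0 : ℝ)) *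
      cPow τ ((-(1 / 2) : ℝ) * z + (0 : ℝ)))
  let G : ℂ → Matrix (R × n) (R × n) ℂ := fun z =>
    L z * cPow σ ((1 / 2 : ℝ) * z + (0 : ℝ)) * cPow X ((-α : ℝ) * z + (α : ℝ)) *
      cPow σ ((1 / 2 : ℝ) * z + (0 : ℝ))
  have hG : IsStripBounded (fun z => (G z).trace) := by
    have hT := IsStripBoundedMatrix.cPow hσR (-(1 / 2)) 0
    have hL := ((hT.mul (IsStripBoundedMatrix.cPow hZp α 0)).mul hT).leftExt (n := n)
    have hS := IsStripBoundedMatrix.cPow hσ (1 / 2) 0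
    exact (((hL.mul hS).mul (IsStripBoundedMatrix.cPow hXp (-α) α)).mul hS).trace
  have h0 : ∀ z : ℂ, z.re = 0 → ‖(G z).trace‖ ≤ a := by
    intro z hz
    have hc1 : IsContraction (cPow σ ((1 / 2 : ℝ) * z + (0 : ℝ))) :=
      isContraction_cPow hσ (by simp [hz])
    have hc2 : IsContraction (L z) :=
      isContraction_leftExt (((isContraction_cPow hσR (by simp [hz])).mul
        (isContraction_cPow hZp (by simp [hz]))).mul (isContraction_cPow hσR (by simp [hz])))
    have hK := (hc1.mul hc2).mul hc1
    have hsplit : cPow X ((-α : ℝ) * z + (α : ℝ)) =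
        cPow X ((α / 2 : ℝ) : ℂ) * cPow X ((-α : ℝ) * z + (α / 2 : ℝ)) := by
      rw [cPow_mul hXp]
      congr 1
      push_cast
      ring
    have e : (G z).trace = (cPow X ((-α : ℝ) * z + (α / 2 : ℝ)) *
        (cPow σ ((1 / 2 : ℝ) * z + (0 : ℝ)) * L z * cPow σ ((1 / 2 : ℝ) * z + (0 : ℝ))) *
        cPow X ((α / 2 : ℝ) : ℂ)).trace := by
      simp only [G]
      rw [hsplit]
      generalize cPow σ ((1 / 2 : ℝ) * z + (0 : ℝ)) = S
      generalize cPow X ((-α : ℝ) * z + (α / 2 : ℝ)) = X1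
      generalize cPow X ((α / 2 : ℝ) : ℂ) = X2
      have e1 : L z * S * (X2 * X1) * S = (L z * S * X2) * (X1 * S) := by noncomm_ring
      rw [e1, trace_mul_comm]
      congr 1
      noncomm_ring
    rw [e]
    refine norm_trace_mul_contraction_mul_le hK ?_ ?_
    · rw [cPow_conjTranspose hXp, cPow_mul hXp]
      refine le_of_eq ?_
      simp only [a]
      congr 3
      apply Complex.ext
      · simp [hz]
      · simp [hz]
    · rw [cPow_conjTranspose hXp, cPow_mul hXp]
      refine le_of_eq ?_
      simp only [a]
      congr 3
      apply Complex.ext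
      · simp
      · simp
  have h1 : ∀ z : ℂ, z.re = 1 → ‖(G z).trace‖ ≤ b := by
    intro z hz
    have hK : IsContraction (cPow X ((-α : ℝ) * z + (α : ℝ))) :=
      isContraction_cPow hXp (by simp [hz])
    have hsplit : cPow Z ((α : ℝ) * z + (0 : ℝ)) =
        cPow Z ((α / 2 : ℝ) : ℂ) * cPow Z ((α : ℝ) * z + (-(α / 2) : ℝ)) := by
      rw [cPow_mul hZp]
      congr 1
      push_cast
      ring
    set S := cPow σ ((1 / 2 : ℝ) * z + (0 : ℝ)) with hS
    set T := cPow τ ((-(1 / 2) : ℝ) * z + (0 : ℝ)) with hT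
    set Z1 := cPow Z ((α / 2 : ℝ) : ℂ) with hZ1
    set Z2 := cPow Z ((α : ℝ) * z + (-(α / 2) : ℝ)) with hZ2
    have e : (G z).trace = ((leftExt (Z2 * T) * S) * cPow X ((-α : ℝ) * z + (α : ℝ)) *
        (S * leftExt (T * Z1))).trace := by
      simp only [G, L]
      rw [hsplit, ← hS, ← hT]
      have e1 : T * (Z1 * Z2) * T = (T * Z1) * (Z2 * T) := by noncomm_ring
      rw [e1, leftExt_mul]
      generalize cPow X ((-α : ℝ) * z + (α : ℝ)) = K
      generalize (leftExt (T * Z1) : Matrix (R × n) (R × n) ℂ) = E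
      generalize (leftExt (Z2 * T) : Matrix (R × n) (R × n) ℂ) = E'
      have e2 : E * E' * S * K * S = E * (E' * S * K * S) := by noncomm_ring
      rw [e2, trace_mul_comm]
      congr 1
      noncomm_ring
    have hSS : Sᴴ * S = σ := by
      rw [hS, cPow_conjTranspose hσ, cPow_mul hσ]
      convert cPow_one hσ using 2
      apply Complex.ext <;> simp [hz]
      norm_num
    have hSS' : S * Sᴴ = σ := by
      rw [hS, cPow_conjTranspose hσ, cPow_mul hσ]
      convert cPow_one hσ using 2
      apply Complex.ext <;> simp [hz]
      norm_num
    have hTT : Tᴴ * τ * T = cPow τ 0 := by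
      conv_lhs => rw [← cPow_one hσR]
      rw [hT, cPow_one hσR, cPow_conjTranspose hσR]
      nth_rw 2 [← cPow_one hσR]
      rw [cPow_mul hσR, cPow_mul hσR]
      congr 1
      apply Complex.ext <;> simp [hz]
      norm_num
    have hTT' : T * τ * Tᴴ = cPow τ 0 := by
      rw [hT, cPow_conjTranspose hσR]
      nth_rw 2 [← cPow_one hσR]
      rw [cPow_mul hσR, cPow_mul hσR]
      congr 1
      apply Complex.ext <;> simp [hz]
      norm_num
    have hZ11 : (Z1ᴴ * Z1).trace.re = b := by
      rw [hZ1, cPow_conjTranspose hZp, cPow_mul hZp]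
      simp only [b]
      congr 3
      apply Complex.ext <;> simp
    have hZ22 : (Z2 * Z2ᴴ).trace.re = b := by
      rw [hZ2, cPow_conjTranspose hZp, cPow_mul hZp]
      simp only [b]
      congr 3
      apply Complex.ext <;> simp [hz]
      ring
    rw [e]
    refine norm_trace_mul_contraction_mul_le hK ?_ ?_
    · rw [← hZ22]
      have e1 : (leftExt (Z2 * T) * S) * (leftExt (Z2 * T) * S)ᴴ =
          leftExt (Z2 * T) * (S * Sᴴ) * leftExt (Z2 * T)ᴴ := by
        rw [conjTranspose_mul, leftExt_conjTranspose]
        noncomm_ring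
      rw [e1, hSS', mul_assoc, trace_leftExt_mul, ptraceRight_mul_leftExt]
      have e2 : Z2 * T * (ptraceRight σ * (Z2 * T)ᴴ) = (Z2ᴴ)ᴴ * (T * τ * Tᴴ) * Z2ᴴ := by
        rw [conjTranspose_mul, conjTranspose_conjTranspose]
        noncomm_ring
      rw [e2, hTT']
      refine (trace_conj_cPow_zero_le hσR).trans ?_
      rw [conjTranspose_conjTranspose]
    · rw [← hZ11]
      have e1 : (S * leftExt (T * Z1))ᴴ * (S * leftExt (T * Z1)) =
          leftExt (T * Z1)ᴴ * (Sᴴ * S) * leftExt (T * Z1) := by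
        rw [conjTranspose_mul, leftExt_conjTranspose]
        noncomm_ring
      rw [e1, hSS, mul_assoc, trace_leftExt_mul, ptraceRight_mul_leftExt]
      have e2 : (T * Z1)ᴴ * (ptraceRight σ * (T * Z1)) = Z1ᴴ * (Tᴴ * τ * T) * Z1 := by
        rw [conjTranspose_mul]
        noncomm_ring
      rw [e2, hTT]
      exact trace_conj_cPow_zero_le hσR
  set θ : ℝ := 1 - 1 / α with hθ
  have hθ0 : 0 < θ := by
    rw [hθ, sub_pos, div_lt_one hα0]; exact hα
  have hθ1 : θ < 1 := by
    rw [hθ]; have := one_div_pos.2 hα0; linarith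
  have hval : (G θ).trace = (cPow Z α).trace := by
    have hkθ : k = -(1 / 2) * θ := by
      rw [hk, hθ]; field_simp; ring
    have eS : cPow σ ((1 / 2 : ℝ) * (θ : ℂ) + (0 : ℝ)) = cPow σ ((-k : ℝ) : ℂ) := by
      rw [hkθ]; congr 1; push_cast; ring
    have eT : cPow τ ((-(1 / 2) : ℝ) * (θ : ℂ) + (0 : ℝ)) = cPow τ k := by
      rw [hkθ]; congr 1; push_cast; ring
    have eX : cPow X ((-α : ℝ) * (θ : ℂ) + (α : ℝ)) = X := by
      conv_rhs => rw [← cPow_one hXp]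
      congr 1
      rw [← Complex.ofReal_mul, ← Complex.ofReal_add, ← Complex.ofReal_one, hθ]
      congr 1
      field_simp; ring
    have eZ : cPow Z ((α : ℝ) * (θ : ℂ) + (0 : ℝ)) * Z = cPow Z α := by
      nth_rw 2 [← cPow_one hZp]
      rw [cPow_mul hZp]
      congr 1
      rw [← Complex.ofReal_mul, ← Complex.ofReal_add, ← Complex.ofReal_one, ← Complex.ofReal_add,
        hθ]
      congr 1
      field_simp; ring
    have eSX : cPow σ ((-k : ℝ) : ℂ) * X * cPow σ ((-k : ℝ) : ℂ) = ρ := by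
      rw [hX]
      have e1 : cPow σ ((-k : ℝ) : ℂ) * (cPow σ k * ρ * cPow σ k) * cPow σ ((-k : ℝ) : ℂ) =
          (cPow σ ((-k : ℝ) : ℂ) * cPow σ k) * (ρ * (cPow σ k * cPow σ ((-k : ℝ) : ℂ))) := by
        noncomm_ring
      rw [e1, cPow_mul hσ, cPow_mul hσ]
      simp [hs, hs']
    simp only [G, L]
    rw [eS, eT, eX]
    have e2 : ∀ E : Matrix (R × n) (R × n) ℂ, E * cPow σ ((-k : ℝ) : ℂ) * X *
        cPow σ ((-k : ℝ) : ℂ) = E * (cPow σ ((-k : ℝ) : ℂ) * X * cPow σ ((-k : ℝ) : ℂ)) := by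
      intro E; noncomm_ring
    rw [e2, eSX, trace_leftExt_mul, ← eZ, hZ]
    generalize cPow (cPow τ k * ptraceRight ρ * cPow τ k) ((α : ℝ) * (θ : ℂ) + (0 : ℝ)) = Y
    rw [mul_assoc, mul_assoc, trace_mul_comm]
    congr 1
    noncomm_ring
  have hmain := hG.norm_le_interp h0 h1 hθ0.le hθ1.le
  rw [hval, norm_trace_cPow_eq hZp] at hmain
  by_contra hlt
  push Not at hlt
  have hb' : 0 < b := lt_of_le_of_lt ha hlt
  have h2 : a ^ (1 - θ) * b ^ θ < b ^ (1 - θ) * b ^ θ :=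
    mul_lt_mul_of_pos_right (Real.rpow_lt_rpow ha hlt (by linarith)) (Real.rpow_pos_of_pos hb' θ)
  rw [← Real.rpow_add hb'] at h2
  simp only [sub_add_cancel, Real.rpow_one] at h2
  exact absurd (hmain.trans_lt h2) (lt_irrefl _)

end DataProcessing

section Support

variable {m : Type} [Fintype m] [DecidableEq m]

theorem mul_cPow_zero {A : Matrix m m ℂ} (hA : A.PosSemidef) : A * cPow A 0 = A := by
  nth_rw 1 [← cPow_one hA]
  rw [cPow_mul hA, add_zero, cPow_one hA]

theorem cPow_neg_one_mul {A : Matrix m m ℂ} (hA : A.PosSemidef) :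
    cPow A (-1) * A = cPow A 0 := by
  nth_rw 2 [← cPow_one hA]
  rw [cPow_mul hA, neg_add_cancel]

theorem suppLE.mul_cPow_zero {ρ σ : Matrix m m ℂ} (hσ : σ.PosSemidef) (h : suppLE ρ σ) :
    ρ * cPow σ 0 = ρ := by
  have h1 : σ * (1 - cPow σ 0) = 0 := by
    rw [mul_sub, mul_one, _root_.mul_cPow_zero hσ, sub_self]
  have h2 : ρ * (1 - cPow σ 0) = 0 := by
    ext i j
    exact congrFun (h (fun l => (1 - cPow σ 0) l j)
      (funext fun i' => congrFun (congrFun h1 i') j)) i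
  rw [mul_sub, mul_one, sub_eq_zero] at h2
  exact h2.symm

theorem suppLE.cPow_zero_mul {ρ σ : Matrix m m ℂ} (hρ : ρ.PosSemidef) (hσ : σ.PosSemidef)
    (h : suppLE ρ σ) : cPow σ 0 * ρ = ρ := by
  have h1 := congrArg conjTranspose (h.mul_cPow_zero hσ)
  rwa [conjTranspose_mul, cPow_conjTranspose hσ, star_zero, hρ.1] at h1

theorem suppLE_mul_left (M σ : Matrix m m ℂ) : suppLE (M * σ) σ := fun v hv => by
  rw [← mulVec_mulVec, hv, mulVec_zero]

theorem trace_cPow_pos {A : Matrix m m ℂ} (hA : A.PosSemidef) (h0 : A ≠ 0) (r : ℝ) :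
    0 < (cPow A r).trace.re := by
  have hP := cPow_ofReal_posSemidef hA r
  have h1 := Complex.le_def.1 hP.trace_nonneg
  refine lt_of_le_of_ne h1.1 fun h2 => h0 ?_
  have h3 : cPow A r = 0 := hP.trace_eq_zero_iff.1 (Complex.ext h2.symm h1.2.symm)
  calc A = cPow A ((1 - r : ℝ) : ℂ) * cPow A r := by
        rw [cPow_mul hA, ← Complex.ofReal_add, sub_add_cancel, Complex.ofReal_one, cPow_one hA]
    _ = 0 := by rw [h3, mul_zero]

theorem ofReal_re_trace {A : Matrix m m ℂ} (hA : A.PosSemidef) :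
    ((A.trace.re : ℝ) : ℂ) = A.trace :=
  Complex.ext rfl (Complex.le_def.1 hA.trace_nonneg).2

theorem cPow_conj_posSemidef {ρ σ : Matrix m m ℂ} (hρ : ρ.PosSemidef) (hσ : σ.PosSemidef)
    (k : ℝ) : (cPow σ k * ρ * cPow σ k).PosSemidef := by
  have h := hρ.mul_mul_conjTranspose_same (cPow σ k)
  rwa [(cPow_ofReal_posSemidef hσ k).1] at h

/-- Sandwiching by a power and its generalized inverse is the identity on the support. -/
theorem cPow_neg_conj_cPow_conj {ρ σ : Matrix m m ℂ} (hσ : σ.PosSemidef)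
    (h : ρ * cPow σ 0 = ρ) (h' : cPow σ 0 * ρ = ρ) (k : ℝ) :
    cPow σ (-k) * (cPow σ k * ρ * cPow σ k) * cPow σ (-k) = ρ := by
  calc _ = (cPow σ (-k) * cPow σ k) * ρ * (cPow σ k * cPow σ (-k)) := by noncomm_ring
    _ = ρ := by rw [cPow_mul hσ, cPow_mul hσ, neg_add_cancel, add_neg_cancel, h', h]

theorem sandRenyi_of_suppLE {ρ σ : Matrix m m ℂ} (hρ : ρ.PosSemidef) (hσ : σ.PosSemidef)
    (h : suppLE ρ σ) {α k : ℝ} (hα : 1 < α) (hk : k = (1 - α) / (2 * α)) :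
    sandRenyi α ρ σ =
      (((α - 1)⁻¹ * Real.logb 2 (cPow (cPow σ k * ρ * cPow σ k) α).trace.re : ℝ) : EReal) := by
  rw [sandRenyi, if_neg hα.ne', if_neg (fun hh => hh.2 h), if_neg (fun hh => hα.not_gt hh.1),
    ← hk, matPow_eq_cPow hσ, matPow_eq_cPow (cPow_conj_posSemidef hρ hσ k)]

theorem sandRenyi_of_not_suppLE {ρ σ : Matrix m m ℂ} (h : ¬ suppLE ρ σ) {α : ℝ} (hα : 1 < α) :
    sandRenyi α ρ σ = ⊤ := by
  rw [sandRenyi, if_neg hα.ne', if_pos ⟨hα, h⟩]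

theorem sandRenyi_self {ρ : Matrix m m ℂ} (hρ : IsDensity ρ) {α : ℝ} (hα : 1 < α) :
    sandRenyi α ρ ρ = 0 := by
  have hα0 : α ≠ 0 := by linarith
  have e : cPow ρ ((1 - α) / (2 * α) : ℝ) * ρ * cPow ρ ((1 - α) / (2 * α) : ℝ) =
      cPow ρ ((1 / α : ℝ) : ℂ) := by
    nth_rw 2 [← cPow_one hρ.1]
    rw [← Complex.ofReal_one, cPow_mul hρ.1, ← Complex.ofReal_add, cPow_mul hρ.1,
      ← Complex.ofReal_add]
    congr 2
    field_simp
    ring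
  rw [sandRenyi_of_suppLE hρ.1 hρ.1 (fun _ h => h) hα rfl, e, cPow_cPow hρ.1,
    one_div_mul_cancel hα0, Complex.ofReal_one, cPow_one hρ.1, hρ.2]
  simp

end Support

section Channel

variable {R ι κ : Type} [Fintype R] [DecidableEq R] [Fintype ι] [DecidableEq ι] [Fintype κ]
  [DecidableEq κ] {N : Matrix ι ι ℂ → Matrix κ κ ℂ}

theorem IsLinearMap.map_sum_smul (hN : IsLinearMap ℂ N) (w : R → ℂ) (B : R → Matrix ι ι ℂ) :
    N (∑ r, w r • B r) = ∑ r, w r • N (B r) :=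
  (map_sum hN.mk' (fun r => w r • B r) Finset.univ).trans
    (Finset.sum_congr rfl fun r _ => hN.map_smul (w r) (B r))

theorem idTensor_leftExt_mul (hN : IsLinearMap ℂ N) (M : Matrix R R ℂ)
    (S : Matrix (R × ι) (R × ι) ℂ) :
    idTensor N (leftExt M * S) = leftExt M * idTensor N S := by
  ext p q
  rw [leftExt_mul_apply]
  have h : (fun a b => (leftExt M * S : Matrix (R × ι) (R × ι) ℂ) (p.1, a) (q.1, b)) =
      ∑ r, M p.1 r • (fun a b => S (r, a) (q.1, b) : Matrix ι ι ℂ) := by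
    ext a b
    simp [leftExt_mul_apply]
  have h2 := hN.map_sum_smul (fun r => M p.1 r) fun r => fun a b => S (r, a) (q.1, b)
  refine (congrFun (congrFun ((congrArg N h).trans h2) p.2) q.2).trans ?_
  exact Matrix.sum_apply _ _ _ _

theorem idTensor_mul_leftExt (hN : IsLinearMap ℂ N) (M : Matrix R R ℂ)
    (S : Matrix (R × ι) (R × ι) ℂ) :
    idTensor N (S * leftExt M) = idTensor N S * leftExt M := by
  ext p q
  rw [mul_leftExt_apply]
  have h : (fun a b => (S * leftExt M : Matrix (R × ι) (R × ι) ℂ) (p.1, a) (q.1, b)) =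
      ∑ r, M r q.1 • (fun a b => S (p.1, a) (r, b) : Matrix ι ι ℂ) := by
    ext a b
    simp [mul_leftExt_apply, mul_comm]
  have h2 := hN.map_sum_smul (fun r => M r q.1) fun r => fun a b => S (p.1, a) (r, b)
  refine (congrFun (congrFun ((congrArg N h).trans h2) p.2) q.2).trans ?_
  refine (Matrix.sum_apply _ _ _ _).trans (Finset.sum_congr rfl fun r _ => ?_)
  exact mul_comm _ _

theorem idTensor_smul (hN : IsLinearMap ℂ N) (c : ℝ) (S : Matrix (R × ι) (R × ι) ℂ) :
    idTensor N (c • S) = c • idTensor N S := by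
  ext p q
  have h := hN.map_smul (c : ℂ) (fun a b => S (p.1, a) (q.1, b))
  have h2 : (fun a b => (c • S) (p.1, a) (q.1, b)) =
      (c : ℂ) • (fun a b => S (p.1, a) (q.1, b) : Matrix ι ι ℂ) := by
    ext a b
    simp
  refine (congrFun (congrFun ((congrArg N h2).trans h) p.2) q.2).trans ?_
  simp [idTensor]

theorem trace_idTensor (hN : ∀ Z, (N Z).trace = Z.trace) (S : Matrix (R × ι) (R × ι) ℂ) :
    (idTensor N S).trace = S.trace := by
  simp only [Matrix.trace, diag_apply, Fintype.sum_prod_type]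
  exact Finset.sum_congr rfl fun r _ => hN fun a b => S (r, a) (r, b)

theorem idTensor_replacer (τ : Matrix κ κ ℂ) (S : Matrix (R × ι) (R × ι) ℂ) :
    idTensor (fun Z => Z.trace • τ) S = ptraceRight S ⊗ₖ τ := by
  ext p q
  rfl

theorem kronecker_eq_leftExt_mul (M : Matrix R R ℂ) (t : Matrix κ κ ℂ) :
    M ⊗ₖ t = leftExt M * ((1 : Matrix R R ℂ) ⊗ₖ t) := by
  ext p q
  simp [leftExt_mul_apply, one_apply]

theorem kronecker_eq_mul_leftExt (M : Matrix R R ℂ) (t : Matrix κ κ ℂ) :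
    M ⊗ₖ t = ((1 : Matrix R R ℂ) ⊗ₖ t) * leftExt M := by
  ext p q
  simp [mul_leftExt_apply, one_apply, mul_comm]

theorem kronecker_conj_idTensor (hN : IsLinearMap ℂ N) (M L : Matrix R R ℂ) (t : Matrix κ κ ℂ)
    (S : Matrix (R × ι) (R × ι) ℂ) :
    (M ⊗ₖ t) * idTensor N S * (L ⊗ₖ t) =
      ((1 : Matrix R R ℂ) ⊗ₖ t) * idTensor N (leftExt M * S * leftExt L) *
        ((1 : Matrix R R ℂ) ⊗ₖ t) := by
  rw [kronecker_eq_mul_leftExt M, kronecker_eq_leftExt_mul L, idTensor_mul_leftExt hN,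
    idTensor_leftExt_mul hN]
  simp only [mul_assoc]

theorem suppLE.mul_leftExt_supp {ρ σ : Matrix (R × ι) (R × ι) ℂ} (hσ : σ.PosSemidef)
    (h : suppLE ρ σ) : ρ * leftExt (cPow (ptraceRight σ) 0) = ρ := by
  have h1 : ρ = ρ * cPow σ (-1) * σ := by
    rw [mul_assoc, cPow_neg_one_mul hσ, h.mul_cPow_zero hσ]
  rw [h1, mul_assoc _ σ, _root_.mul_leftExt_supp hσ]

theorem suppLE.ptraceRight_mul_supp {ρ σ : Matrix (R × ι) (R × ι) ℂ} (hσ : σ.PosSemidef)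
    (h : suppLE ρ σ) : ptraceRight ρ * cPow (ptraceRight σ) 0 = ptraceRight ρ := by
  rw [← ptraceRight_mul_leftExt, h.mul_leftExt_supp hσ]

theorem suppLE.ptraceRight_kronecker {ρ σ : Matrix (R × ι) (R × ι) ℂ} (hσ : σ.PosSemidef)
    (h : suppLE ρ σ) (τ : Matrix κ κ ℂ) :
    suppLE (ptraceRight ρ ⊗ₖ τ) (ptraceRight σ ⊗ₖ τ) := by
  have hT := ptraceRight_posSemidef hσ
  have h1 : ptraceRight ρ = ptraceRight ρ * cPow (ptraceRight σ) (-1) * ptraceRight σ := by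
    rw [mul_assoc, cPow_neg_one_mul hT, h.ptraceRight_mul_supp hσ]
  have h2 : ptraceRight ρ ⊗ₖ τ =
      leftExt (ptraceRight ρ * cPow (ptraceRight σ) (-1)) * (ptraceRight σ ⊗ₖ τ) := by
    rw [kronecker_eq_leftExt_mul (ptraceRight σ), ← mul_assoc, ← leftExt_mul, ← h1,
      ← kronecker_eq_leftExt_mul]
  rw [h2]
  exact suppLE_mul_left _ _

end Channel

section Amortization

variable {R ι κ : Type} [Fintype R] [DecidableEq R] [Fintype ι] [DecidableEq ι] [Fintype κ]
  [DecidableEq κ] {N : Matrix ι ι ℂ → Matrix κ κ ℂ}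

set_option maxHeartbeats 1000000 in
/-- For a replacer channel, the amortized value at a pair of inputs `ρ`, `σ` with finite divergences
is bounded by the divergence at a single input state. -/
theorem exists_density_sandRenyi_sub_le (hN : IsLinearMap ℂ N)
    (hNt : ∀ Z, (N Z).trace = Z.trace)
    (hNp : ∀ S : Matrix (R × ι) (R × ι) ℂ, S.PosSemidef → (idTensor N S).PosSemidef)
    {τ : Matrix κ κ ℂ} (hτ : τ.PosSemidef) {ρ σ : Matrix (R × ι) (R × ι) ℂ} (hρ : IsDensity ρ)
    (hσ : σ.PosSemidef) (hs : suppLE ρ σ)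
    (hs' : suppLE (idTensor N ρ) (ptraceRight σ ⊗ₖ τ)) {α : ℝ} (hα : 1 < α) :
    ∃ ψ : Matrix (R × ι) (R × ι) ℂ, IsDensity ψ ∧
      sandRenyi α (idTensor N ρ) (ptraceRight σ ⊗ₖ τ) - sandRenyi α ρ σ ≤
        sandRenyi α (idTensor N ψ) (ptraceRight ψ ⊗ₖ τ) := by
  have hα0 : 0 < α := by linarith
  obtain ⟨k, hk⟩ : ∃ k : ℝ, k = (1 - α) / (2 * α) := ⟨_, rfl⟩
  have hkα : α * k = (1 - α) / 2 := by rw [hk]; field_simp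
  have hT := ptraceRight_posSemidef hσ
  set T := ptraceRight σ
  have hTτ : (T ⊗ₖ τ).PosSemidef := hT.kronecker hτ
  have hNρ := hNp ρ hρ.1
  set s := cPow T k
  have hsH : sᴴ = s := (cPow_ofReal_posSemidef hT k).1
  set X : Matrix (R × ι) (R × ι) ℂ := leftExt s * ρ * leftExt s
  have hX : X.PosSemidef := by
    have h := hρ.1.mul_mul_conjTranspose_same (leftExt s)
    rwa [leftExt_conjTranspose, hsH] at h
  have hQ := ptraceRight_posSemidef hX
  have hQe : ptraceRight X = s * ptraceRight ρ * s := by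
    rw [ptraceRight_mul_leftExt, ptraceRight_leftExt_mul]
  set Q := ptraceRight X
  have hρT : ptraceRight ρ * cPow T 0 = ptraceRight ρ := hs.ptraceRight_mul_supp hσ
  have hTρ : cPow T 0 * ptraceRight ρ = ptraceRight ρ := by
    have h1 := congrArg conjTranspose hρT
    rwa [conjTranspose_mul, cPow_conjTranspose hT, star_zero,
      (ptraceRight_posSemidef hρ.1).1] at h1
  have hQ0 : Q ≠ 0 := fun h0 => by
    have h1 := cPow_neg_conj_cPow_conj hT hρT hTρ k
    rw [← hQe, h0, mul_zero, zero_mul] at h1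
    have h2 := trace_ptraceRight ρ
    rw [← h1, hρ.2, trace_zero] at h2
    exact zero_ne_one h2
  set c := (cPow Q α).trace.re
  have hc : 0 < c := trace_cPow_pos hQ hQ0 α
  have hci : 0 < c⁻¹ := inv_pos.2 hc
  have hcα : (c : ℂ) = (cPow Q α).trace := ofReal_re_trace (cPow_ofReal_posSemidef hQ α)
  set u := cPow Q ((α - 1) / 2 : ℝ)
  have huH : uᴴ = u := (cPow_ofReal_posSemidef hQ _).1
  set ψ : Matrix (R × ι) (R × ι) ℂ := c⁻¹ • (leftExt u * X * leftExt u)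
  have hψR : ptraceRight ψ = c⁻¹ • cPow Q α := by
    rw [ptraceRight_smul, ptraceRight_mul_leftExt, ptraceRight_leftExt_mul]
    congr 1
    calc u * Q * u = u * cPow Q (1 : ℝ) * u := by rw [Complex.ofReal_one, cPow_one hQ]
      _ = cPow Q (((α - 1) / 2 + 1 + (α - 1) / 2 : ℝ) : ℂ) := by
        rw [cPow_mul hQ, ← Complex.ofReal_add, cPow_mul hQ, ← Complex.ofReal_add]
      _ = cPow Q α := by
        congr 2
        ring
  have hψ : IsDensity ψ := by
    constructor
    · have h := hX.mul_mul_conjTranspose_same (leftExt u)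
      rw [leftExt_conjTranspose, huH] at h
      exact h.smul hci.le
    · rw [← trace_ptraceRight, hψR, trace_smul, ← hcα, Complex.real_smul, ← Complex.ofReal_mul,
        inv_mul_cancel₀ hc.ne', Complex.ofReal_one]
  refine ⟨ψ, hψ, ?_⟩
  by_cases hsψ : suppLE (idTensor N ψ) (ptraceRight ψ ⊗ₖ τ)
  swap
  · rw [sandRenyi_of_not_suppLE hsψ hα]
    exact le_top
  have hψRp := ptraceRight_posSemidef hψ.1
  set Y := cPow (T ⊗ₖ τ) k * idTensor N ρ * cPow (T ⊗ₖ τ) k with hYd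
  have hY : Y.PosSemidef := cPow_conj_posSemidef hNρ hTτ k
  have hY0 : Y ≠ 0 := fun h0 => by
    have h1 := cPow_neg_conj_cPow_conj hTτ (hs'.mul_cPow_zero hTτ) (hs'.cPow_zero_mul hNρ hTτ) k
    rw [← hYd, h0, mul_zero, zero_mul] at h1
    have h2 := trace_idTensor hNt ρ
    rw [← h1, hρ.2, trace_zero] at h2
    exact zero_ne_one h2
  have hYX : Y = ((1 : Matrix R R ℂ) ⊗ₖ cPow τ k) * idTensor N X *
      ((1 : Matrix R R ℂ) ⊗ₖ cPow τ k) := by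
    rw [hYd, cPow_kronecker hT hτ, kronecker_conj_idTensor hN]
  obtain ⟨d, hd⟩ : ∃ d : ℝ, d = (c⁻¹) ^ k := ⟨_, rfl⟩
  have hd0 : 0 < d := hd ▸ Real.rpow_pos_of_pos hci k
  have hv : cPow (ptraceRight ψ) k = d • cPow Q ((α * k : ℝ) : ℂ) := by
    rw [hψR, cPow_smul_cPow hQ hci, hd]
  have hvu : cPow Q ((α * k : ℝ) : ℂ) * u = cPow Q 0 := by
    rw [cPow_mul hQ, ← Complex.ofReal_add, hkα, show (1 - α) / 2 + (α - 1) / 2 = 0 by ring,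
      Complex.ofReal_zero]
  have huv : u * cPow Q ((α * k : ℝ) : ℂ) = cPow Q 0 := by
    rw [cPow_mul hQ, ← Complex.ofReal_add, hkα, show (α - 1) / 2 + (1 - α) / 2 = 0 by ring,
      Complex.ofReal_zero]
  have hW : leftExt (cPow (ptraceRight ψ) k) * ψ * leftExt (cPow (ptraceRight ψ) k) =
      (d * c⁻¹ * d) • X := by
    rw [hv, leftExt_smul]
    simp only [ψ, smul_mul_assoc, mul_smul_comm, smul_smul]
    congr 1
    · ring
    calc _ = leftExt (cPow Q ((α * k : ℝ) : ℂ)) * leftExt u * X *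
          (leftExt u * leftExt (cPow Q ((α * k : ℝ) : ℂ))) := by noncomm_ring
      _ = X := by
        rw [← leftExt_mul, ← leftExt_mul, hvu, huv, leftExt_supp_mul hX,
          _root_.mul_leftExt_supp hX]
  have hZ : cPow (ptraceRight ψ ⊗ₖ τ) k * idTensor N ψ * cPow (ptraceRight ψ ⊗ₖ τ) k =
      (d * c⁻¹ * d) • Y := by
    rw [cPow_kronecker hψRp hτ, kronecker_conj_idTensor hN, hW, idTensor_smul hN, hYX,
      mul_smul_comm, smul_mul_assoc]
  have hdc : (d * c⁻¹ * d) ^ α = c⁻¹ := by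
    have h1 : d * c⁻¹ * d = (c⁻¹) ^ (k + 1 + k) := by
      rw [Real.rpow_add hci, Real.rpow_add hci, Real.rpow_one, hd]
    rw [h1, ← Real.rpow_mul hci.le, show (k + 1 + k) * α = 1 by linarith, Real.rpow_one]
  have hb := trace_cPow_pos hY hY0 α
  have hdpi := trace_sandwich_ptraceRight_le hρ.1 hσ (hs.mul_cPow_zero hσ)
    (hs.cPow_zero_mul hρ.1 hσ) hα hk rfl hQe
  rw [sandRenyi_of_suppLE hNρ hTτ hs' hα hk, sandRenyi_of_suppLE hρ.1 hσ hs hα hk,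
    sandRenyi_of_suppLE (hNp ψ hψ.1) (hψRp.kronecker hτ) hsψ hα hk, hZ,
    cPow_smul hY (by positivity), hdc, ← EReal.coe_sub, EReal.coe_le_coe_iff, trace_smul,
    Complex.smul_re, smul_eq_mul, Real.logb_mul hci.ne' hb.ne', Real.logb_inv]
  have hlog := Real.logb_le_logb_of_le one_lt_two hc hdpi
  have hα1 : 0 ≤ (α - 1)⁻¹ := inv_nonneg.2 (by linarith)
  rw [← mul_sub]
  exact mul_le_mul_of_nonneg_left (by linarith) hα1

end Amortization

/-- Amortization collapse of the sandwiched Rényi divergence for replacer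
channels: for every `α > 1`, `D̃_α^𝒜(N‖R) = D̃_α(N‖R)`. -/
theorem replacer_sandRenyi_amortization_collapse
    {ι κ : Type} [Fintype ι] [DecidableEq ι] [Fintype κ] [DecidableEq κ]
    (N : Matrix ι ι ℂ → Matrix κ κ ℂ) (hN : IsChannel N)
    (τ : Matrix κ κ ℂ) (hτ : IsDensity τ)
    (α : ℝ) (hα : 1 < α) :
    amortizedDiv (sandFam α) N (fun Z => Z.trace • τ) =
      channelDiv (sandFam α) N (fun Z => Z.trace • τ) := by
  have hp : ∀ {R : ℕ} (S : Matrix (Fin R × ι) (Fin R × ι) ℂ), S.PosSemidef →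
      (idTensor N S : Matrix (Fin R × κ) (Fin R × κ) ℂ).PosSemidef := fun S hS => hN.compPos _ S hS
  apply le_antisymm
  · refine iSup_le fun R => iSup_le fun ρ => iSup_le fun σ => iSup_le fun hρ => iSup_le fun hσ => ?_
    by_cases hs : suppLE ρ σ
    swap
    · rw [sandFam, sandFam, sandRenyi_of_not_suppLE hs hα, EReal.sub_top]
      exact bot_le
    by_cases hs' : suppLE (idTensor N ρ) (ptraceRight σ ⊗ₖ τ)
    · obtain ⟨ψ, hψ, h⟩ := exists_density_sandRenyi_sub_le hN.linear hN.tracePres hp hτ.1 hρ hσ.1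
        hs hs' hα
      rw [← idTensor_replacer, ← idTensor_replacer] at h
      refine le_trans ?_ (le_iSup_of_le R (le_iSup_of_le ψ (le_iSup_of_le hψ le_rfl)))
      exact h
    · have hn : ¬ suppLE (idTensor N ρ) (idTensor (fun Z => Z.trace • τ) ρ) := fun h => hs' (by
        rw [idTensor_replacer] at h
        exact fun v hv => h v (hs.ptraceRight_kronecker hσ.1 τ v hv))
      refine le_trans le_top (le_iSup_of_le R (le_iSup_of_le ρ (le_iSup_of_le hρ ?_)))
      rw [sandFam, sandRenyi_of_not_suppLE hn hα]
  · refine iSup_le fun R => iSup_le fun ρ => iSup_le fun hρ => ?_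
    refine le_trans ?_ (le_iSup_of_le R (le_iSup_of_le ρ (le_iSup_of_le ρ (le_iSup_of_le hρ
      (le_iSup_of_le hρ le_rfl)))))
    have h0 : sandFam α (Fin R × ι) ρ ρ = 0 := sandRenyi_self hρ hα
    rw [h0, sub_zero]

end
end
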